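/- For every integer ℓ ≥ 2, there exist constants C > 0, δ > 0 and k₀ ∈ ℕ such that for each n ∈ ℕ, if G is an n-vertex graph with k·n^{1+1/ℓ} edges where k ≥ k₀, then there exists a collection 𝓕 of copies of the even cycle C_{2ℓ} in G such that: (a) |𝓕| ≥ δ·k^{2ℓ}·n²; and (b) for every S ⊆ E(G) with 1 ≤ |S| ≤ 2ℓ − 1, d_𝓕(S) ≤ C·k^{2ℓ − |S| − (|S|−1)/(ℓ−1)}·n^{1 − 1/ℓ}. -/

import Mathlib

set_option autoImplicit false

open Finset Filter MeasureTheory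

/-- `G` is an `r`-uniform hypergraph: every edge has exactly `r` vertices. -/
def UniformHG (r : ℕ) {V : Type*} (G : Finset (Finset V)) : Prop :=
  ∀ e ∈ G, e.card = r

/-- The set of vertices spanned by an edge set. -/
def vertsHG {V : Type*} [DecidableEq V] (G : Finset (Finset V)) : Finset V :=
  G.biUnion id

/-- `A` is (the edge set of) a copy of `H` in `G`. -/
def IsCopy {V W : Type*} [DecidableEq V] [DecidableEq W]
    (H : Finset (Finset V)) (G : Finset (Finset W)) (A : Finset (Finset W)) : Prop :=
  ∃ f : V → W, Function.Injective f ∧ A = H.image (fun e => e.image f) ∧ A ⊆ G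

/-- The set of copies of `H` in `G`, each copy identified with its edge set. -/
def copies {V W : Type*} [DecidableEq V] [DecidableEq W]
    (H : Finset (Finset V)) (G : Finset (Finset W)) : Set (Finset (Finset W)) :=
  {A | IsCopy H G A}

/-- `G` contains no copy of `H`. -/
def HFree {V W : Type*} [DecidableEq V] [DecidableEq W]
    (H : Finset (Finset V)) (G : Finset (Finset W)) : Prop :=
  ∀ A, ¬ IsCopy H G A

/-- The extremal number `ex(n, H)`: the maximum number of edges in an `H`-free
`r`-uniform hypergraph on `n` vertices. -/
noncomputable def exN {V : Type*} [DecidableEq V] (r : ℕ) (H : Finset (Finset V)) (n : ℕ) : ℕ :=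
  sSup {m | ∃ G : Finset (Finset (Fin n)), UniformHG r G ∧ HFree H G ∧ G.card = m}

/-- The degree `d_F(S)` of an edge set `S` in a family `F` of copies. -/
def degF {W : Type*} [DecidableEq W]
    (F : Finset (Finset (Finset W))) (S : Finset (Finset W)) : ℕ :=
  (F.filter fun B => S ⊆ B).card

/-- `H` is `r`-partite: the vertices can be `r`-colored so that every edge meets each
color class in exactly one vertex. -/
def MultipartiteHG (r : ℕ) {V : Type*} (H : Finset (Finset V)) : Prop :=
  ∃ c : V → Fin r, ∀ e ∈ H, ∀ i : Fin r, ∃! v, v ∈ e ∧ c v = i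

/-- The `r`-density `m_r(H)`. -/
noncomputable def mDen (r : ℕ) {V : Type*} [DecidableEq V] (H : Finset (Finset V)) : ℝ :=
  sSup {x : ℝ | ∃ F, F ⊆ H ∧ r < (vertsHG F).card ∧
    x = ((F.card : ℝ) - 1) / (((vertsHG F).card : ℝ) - (r : ℝ))}

/-- The proper `r`-density `m*_r(H)`. -/
noncomputable def mDenStar (r : ℕ) {V : Type*} [DecidableEq V] (H : Finset (Finset V)) : ℝ :=
  sSup {x : ℝ | ∃ F, F ⊂ H ∧ r < (vertsHG F).card ∧
    x = ((F.card : ℝ) - 1) / (((vertsHG F).card : ℝ) - (r : ℝ))}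

/-- `λ(α,H) = 1/(m_r(H)(r−α))`. -/
noncomputable def lamHG (r : ℕ) {V : Type*} [DecidableEq V] (α : ℝ) (H : Finset (Finset V)) : ℝ :=
  1 / (mDen r H * ((r : ℝ) - α))

/-- `λ*(α,H) = 1/(m*_r(H)(r−α))`. -/
noncomputable def lamStarHG (r : ℕ) {V : Type*} [DecidableEq V] (α : ℝ) (H : Finset (Finset V)) : ℝ :=
  1 / (mDenStar r H * ((r : ℝ) - α))

/-- The cycle on `m` vertices, as a `2`-uniform hypergraph on `Fin m`. -/
def cycleGraph (m : ℕ) : Finset (Finset (Fin m)) :=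
  Finset.univ.image fun i : Fin m =>
    ({i, ⟨(i.val + 1) % m, Nat.mod_lt _ i.pos⟩} : Finset (Fin m))

section Sequences

open scoped Classical

theorem card_le_mul_card_of_fibers {α β : Type*} [DecidableEq β] {s : Finset α} {t : Finset β}
    (f : α → β) (hf : ∀ a ∈ s, f a ∈ t) {c : ℝ}
    (hc : ∀ b ∈ t, ((s.filter fun a => f a = b).card : ℝ) ≤ c) :
    (s.card : ℝ) ≤ c * t.card := by
  rw [Finset.card_eq_sum_card_fiberwise hf]
  push_cast
  calc ∑ b ∈ t, ((s.filter fun a => f a = b).card : ℝ) ≤ ∑ _b ∈ t, c := sum_le_sum hc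
    _ = c * t.card := by rw [sum_const, nsmul_eq_mul, mul_comm]

/-- The functions `ℕ → V` that are constant from `L` on. -/
noncomputable def seqs (V : Type*) [Fintype V] (L : ℕ) : Finset (ℕ → V) :=
  univ.image fun (f : Fin (L + 1) → V) (i : ℕ) => f ⟨min i L, by omega⟩

/-- The restriction of a sequence to `{0, …, a}`, continued as a constant. -/
def trunc {V : Type*} (a : ℕ) (w : ℕ → V) : ℕ → V := fun i => w (min i a)

variable {V : Type*} [Fintype V]

theorem mem_seqs {L : ℕ} {w : ℕ → V} : w ∈ seqs V L ↔ ∀ i, L ≤ i → w i = w L := by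
  simp only [seqs, mem_image, mem_univ, true_and]
  constructor
  · rintro ⟨f, rfl⟩ i hi
    simp [hi]
  · intro h
    refine ⟨fun j => w j, funext fun i => ?_⟩
    rcases le_total i L with hi | hi
    · simp [hi]
    · simp [hi, h i hi]

theorem trunc_mem_seqs (a : ℕ) (w : ℕ → V) : trunc a w ∈ seqs V a := by
  rw [mem_seqs]; intro i hi; simp [trunc, hi]

theorem trunc_apply {V : Type*} {a i : ℕ} (w : ℕ → V) (h : i ≤ a) : trunc a w i = w i := by
  simp [trunc, h]

theorem trunc_trunc {V : Type*} {a b : ℕ} (w : ℕ → V) (h : a ≤ b) :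
    trunc a (trunc b w) = trunc a w := by
  funext i; simp only [trunc]; congr 1; omega

theorem trunc_eq_self {L : ℕ} {w : ℕ → V} (hw : w ∈ seqs V L) : trunc L w = w := by
  funext i
  rcases le_total i L with hi | hi
  · simp [trunc, hi]
  · simp [trunc, hi, mem_seqs.1 hw i hi]

/-- The sequences of length `L` extending a member of `P` at time `t`, with each later entry
chosen from `σ` according to the history. -/
noncomputable def extensions (P : Finset (ℕ → V)) (t : ℕ) (σ : ℕ → (ℕ → V) → Finset V) (L : ℕ) :
    Finset (ℕ → V) :=
  (seqs V L).filter fun w =>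
    trunc t w ∈ P ∧ ∀ i, t ≤ i → i < L → w (i + 1) ∈ σ i (trunc i w)

theorem mem_extensions {P : Finset (ℕ → V)} {t : ℕ} {σ : ℕ → (ℕ → V) → Finset V} {L : ℕ}
    {w : ℕ → V} : w ∈ extensions P t σ L ↔ w ∈ seqs V L ∧ trunc t w ∈ P ∧
      ∀ i, t ≤ i → i < L → w (i + 1) ∈ σ i (trunc i w) := by
  simp [extensions]

theorem trunc_mem_extensions {P : Finset (ℕ → V)} {t : ℕ} {σ : ℕ → (ℕ → V) → Finset V} {K L : ℕ}
    (htK : t ≤ K) (hKL : K ≤ L) {w : ℕ → V} (hw : w ∈ extensions P t σ L) :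
    trunc K w ∈ extensions P t σ K := by
  rw [mem_extensions] at hw ⊢
  refine ⟨trunc_mem_seqs _ _, by rw [trunc_trunc _ htK]; exact hw.2.1, fun i h1 h2 => ?_⟩
  rw [trunc_trunc _ h2.le, trunc_apply _ (by omega)]
  exact hw.2.2 i h1 (by omega)

theorem card_extensions_succ (P : Finset (ℕ → V)) (t : ℕ) (σ : ℕ → (ℕ → V) → Finset V) (L : ℕ)
    (htL : t ≤ L) :
    (extensions P t σ (L + 1)).card = ∑ w ∈ extensions P t σ L, (σ L w).card := by
  rw [← Finset.card_sigma]
  refine Finset.card_bij' (fun w _ => ⟨trunc L w, w (L + 1)⟩)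
    (fun p _ => fun i => if i ≤ L then p.1 i else p.2) ?_ ?_ ?_ ?_
  · intro w hw
    rw [Finset.mem_sigma]
    exact ⟨trunc_mem_extensions htL (by omega) hw, (mem_extensions.1 hw).2.2 L htL (by omega)⟩
  · rintro ⟨w, y⟩ hp
    rw [Finset.mem_sigma] at hp
    obtain ⟨h1, h2⟩ := hp
    dsimp only at h1 h2 ⊢
    rw [mem_extensions] at h1 ⊢
    have key : ∀ i, i ≤ L → trunc i (fun i => if i ≤ L then w i else y) = trunc i w := by
      intro i hi
      funext j
      simp only [trunc]
      rw [if_pos (by omega)]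
    refine ⟨?_, ?_, ?_⟩
    · rw [mem_seqs]; intro i hi
      rw [if_neg (by omega), if_neg (by omega)]
    · rw [key t htL]; exact h1.2.1
    · intro i hi hiL
      rw [key i (by omega)]
      rcases Nat.lt_or_ge i L with h | h
      · rw [if_pos (by omega)]; exact h1.2.2 i hi h
      · have : i = L := by omega
        subst this
        rw [if_neg (by omega), trunc_eq_self h1.1]; exact h2
  · intro w hw
    have h := mem_seqs.1 (mem_extensions.1 hw).1
    funext i
    dsimp only
    split_ifs with hi
    · exact trunc_apply _ hi
    · exact (h i (by omega)).symm
  · rintro ⟨w, y⟩ hp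
    rw [Finset.mem_sigma] at hp
    have h1 := (mem_extensions.1 hp.1).1
    dsimp only at h1 ⊢
    rw [if_neg (by omega)]
    congr 1
    conv_rhs => rw [← trunc_eq_self h1]
    funext j
    simp only [trunc]
    rw [if_pos (by omega)]

theorem extensions_self_subset (P : Finset (ℕ → V)) (t : ℕ) (σ : ℕ → (ℕ → V) → Finset V) :
    extensions P t σ t ⊆ P := by
  intro w hw
  have h := mem_extensions.1 hw
  rw [← trunc_eq_self h.1]; exact h.2.1

theorem card_extensions_le (P : Finset (ℕ → V)) {t : ℕ} {σ : ℕ → (ℕ → V) → Finset V} {L : ℕ}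
    (htL : t ≤ L) {a : ℕ → ℝ}
    (ha : ∀ i, t ≤ i → i < L → ∀ w, ((σ i w).card : ℝ) ≤ a i) :
    ((extensions P t σ L).card : ℝ) ≤ P.card * ∏ i ∈ Ico t L, a i := by
  induction L, htL using Nat.le_induction with
  | base => simpa using card_le_card (extensions_self_subset P t σ)
  | succ L htL ih =>
    rw [card_extensions_succ _ _ _ _ htL, Finset.prod_Ico_succ_top htL, ← mul_assoc]
    push_cast
    have ih' := ih fun i h1 h2 => ha i h1 (by omega)
    rcases (extensions P t σ L).eq_empty_or_nonempty with he | ⟨w, hw⟩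
    · rw [he] at ih' ⊢
      rw [sum_empty]
      rcases isEmpty_or_nonempty (ℕ → V) with h | ⟨⟨w⟩⟩
      · have : P = ∅ := by
          ext w; exact h.elim w
        simp [this]
      · exact mul_nonneg (by simpa using ih')
          ((Nat.cast_nonneg _).trans (ha L htL (by omega) w))
    · have h0 : 0 ≤ a L := (Nat.cast_nonneg _).trans (ha L htL (by omega) w)
      calc ∑ w ∈ extensions P t σ L, ((σ L w).card : ℝ)
          ≤ ∑ _w ∈ extensions P t σ L, a L := sum_le_sum fun w _ => ha L htL (by omega) w
        _ = (extensions P t σ L).card * a L := by rw [sum_const, nsmul_eq_mul]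
        _ ≤ _ := mul_le_mul_of_nonneg_right ih' h0

theorem le_card_extensions {P : Finset (ℕ → V)} {t : ℕ} {σ : ℕ → (ℕ → V) → Finset V} {L : ℕ}
    (htL : t ≤ L) {a : ℕ → ℝ} (h0 : ∀ i, 0 ≤ a i) (hP : P ⊆ seqs V t)
    (ha : ∀ i, t ≤ i → i < L → ∀ w ∈ extensions P t σ i, a i ≤ ((σ i w).card : ℝ)) :
    P.card * ∏ i ∈ Ico t L, a i ≤ ((extensions P t σ L).card : ℝ) := by
  induction L, htL using Nat.le_induction with
  | base =>
    simp only [Ico_self, prod_empty, mul_one, Nat.cast_le]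
    refine card_le_card fun w hw => mem_extensions.2 ⟨hP hw, ?_, fun i _ _ => by omega⟩
    rwa [trunc_eq_self (hP hw)]
  | succ L htL ih =>
    rw [card_extensions_succ _ _ _ _ htL, Finset.prod_Ico_succ_top htL, ← mul_assoc]
    push_cast
    have ih' := ih fun i h1 h2 => ha i h1 (by omega)
    calc _ ≤ (extensions P t σ L).card * a L := mul_le_mul_of_nonneg_right ih' (h0 L)
      _ = ∑ _w ∈ extensions P t σ L, a L := by rw [sum_const, nsmul_eq_mul]
      _ ≤ _ := sum_le_sum fun w hw => ha L htL (by omega) w hw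

/-- Restricting the choice at time `i` to at most `s` values reduces the upper bound for the number
of extensions by the factor `s / a i`. -/
theorem card_filter_extensions_mul_le (P : Finset (ℕ → V)) {t : ℕ} {σ : ℕ → (ℕ → V) → Finset V}
    {L i : ℕ} (hti : t ≤ i) (hiL : i < L) {a : ℕ → ℝ}
    (ha : ∀ i, t ≤ i → i < L → ∀ w, ((σ i w).card : ℝ) ≤ a i)
    (A : Finset (ℕ → V)) (hA : A ⊆ extensions P t σ L)
    (τ : (ℕ → V) → Finset V) {s : ℝ} (hτ : ∀ w, ((τ w).card : ℝ) ≤ s)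
    (hAτ : ∀ w ∈ A, w (i + 1) ∈ τ (trunc i w)) (hai : 0 ≤ a i) :
    (A.card : ℝ) * a i ≤ s * (P.card * ∏ j ∈ Ico t L, a j) := by
  have hsub : A ⊆ extensions P t (Function.update σ i τ) L := by
    intro w hw
    have h := mem_extensions.1 (hA hw)
    refine mem_extensions.2 ⟨h.1, h.2.1, fun j h1 h2 => ?_⟩
    by_cases hj : j = i
    · subst hj; simpa using hAτ w hw
    · rw [Function.update_of_ne hj]; exact h.2.2 j h1 h2
  have h1 : ((extensions P t (Function.update σ i τ) L).card : ℝ) ≤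
      P.card * ∏ j ∈ Ico t L, Function.update a i s j := by
    refine card_extensions_le P (by omega) fun j h1 h2 w => ?_
    by_cases hj : j = i
    · subst hj; simpa using hτ w
    · rw [Function.update_of_ne hj, Function.update_of_ne hj]; exact ha j h1 h2 w
  have hmem : i ∈ Ico t L := mem_Ico.2 ⟨hti, hiL⟩
  rw [Finset.prod_update_of_mem hmem] at h1
  have h2 : ∏ j ∈ Ico t L, a j = a i * ∏ j ∈ Ico t L \ {i}, a j := by
    rw [← Finset.prod_update_of_mem hmem, Function.update_eq_self]
  rw [h2]
  calc (A.card : ℝ) * a i ≤ (P.card * (s * ∏ j ∈ Ico t L \ {i}, a j)) * a i :=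
        mul_le_mul_of_nonneg_right ((Nat.cast_le.2 (card_le_card hsub)).trans h1) hai
    _ = _ := by ring

/-- Walks of length `L` from `x` along the out-neighbourhoods `N`. -/
noncomputable def outWalks (N : V → Finset V) (x : V) (L : ℕ) : Finset (ℕ → V) :=
  extensions {fun _ => x} 0 (fun i w => N (w i)) L

theorem mem_outWalks {N : V → Finset V} {x : V} {L : ℕ} {w : ℕ → V} :
    w ∈ outWalks N x L ↔ w ∈ seqs V L ∧ w 0 = x ∧ ∀ i, i < L → w (i + 1) ∈ N (w i) := by
  rw [outWalks, mem_extensions, mem_singleton]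
  refine and_congr Iff.rfl (and_congr ⟨fun h => ?_, fun h => ?_⟩ ⟨fun h i hi => ?_, fun h i _ hi => ?_⟩)
  · simpa [trunc] using congrFun h 0
  · funext i; simp [trunc, h]
  · simpa [trunc] using h i (Nat.zero_le _) hi
  · simpa [trunc] using h i hi

theorem card_outWalks_le {N : V → Finset V} {d : ℕ} (hN : ∀ v, (N v).card ≤ d) (x : V) (L : ℕ) :
    ((outWalks N x L).card : ℝ) ≤ (d : ℝ) ^ L := by
  have := card_extensions_le {fun _ => x} (σ := fun i w => N (w i)) (Nat.zero_le L)
    (a := fun _ => (d : ℝ)) fun i _ _ w => by exact_mod_cast hN (w i)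
  simpa [outWalks] using this

/-- The number of walks of length `i` from `u` to `v`. -/
noncomputable def walkCount (N : V → Finset V) (i : ℕ) (u v : V) : ℕ :=
  ((outWalks N u i).filter fun w => w i = v).card

theorem shift_mem_outWalks {N : V → Finset V} {x : V} {a L : ℕ} {w : ℕ → V}
    (hw : w ∈ outWalks N x (a + L)) : (fun i => w (a + i)) ∈ outWalks N (w a) L := by
  rw [mem_outWalks] at hw ⊢
  refine ⟨mem_seqs.2 fun i hi => mem_seqs.1 hw.1 (a + i) (by omega), rfl, fun i hi => ?_⟩
  exact hw.2.2 (a + i) (by omega)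

theorem trunc_mem_outWalks {N : V → Finset V} {x : V} {a L : ℕ} (h : a ≤ L) {w : ℕ → V}
    (hw : w ∈ outWalks N x L) : trunc a w ∈ outWalks N x a :=
  trunc_mem_extensions (Nat.zero_le _) h hw

theorem eq_of_trunc_eq_of_shift_eq {V : Type*} {a : ℕ} {w w' : ℕ → V} (h1 : trunc a w = trunc a w')
    (h2 : ∀ i, w (a + i) = w' (a + i)) : w = w' := by
  funext i
  rcases le_total i a with h | h
  · rw [← trunc_apply w h, h1, trunc_apply w' h]
  · obtain ⟨j, rfl⟩ := Nat.exists_eq_add_of_le h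
    exact h2 j

end Sequences

section Walks

open scoped Classical

variable {V : Type*} [Fintype V]

theorem card_fiber_trunc_le_walkCount {N : V → Finset V} {x y u : V} {κ s : ℕ} (hκ : κ ≤ s)
    (A : Finset (ℕ → V)) (hA : A ⊆ outWalks N x s) (hy : ∀ w ∈ A, w s = y)
    (hu : ∀ w ∈ A, w κ = u) (w' : ℕ → V) :
    (A.filter fun w => trunc κ w = w').card ≤ walkCount N (s - κ) u y := by
  refine Finset.card_le_card_of_injOn (fun w i => w (κ + i)) ?_ ?_
  · intro w hw
    simp only [coe_filter, Set.mem_ofPred_eq] at hw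
    have h1 : w ∈ outWalks N x (κ + (s - κ)) := by
      rw [Nat.add_sub_cancel' hκ]; exact hA hw.1
    have h2 := shift_mem_outWalks h1
    simp only [coe_filter, Set.mem_ofPred_eq]
    rw [hu w hw.1] at h2
    refine ⟨h2, ?_⟩
    rw [Nat.add_sub_cancel' hκ]; exact hy w hw.1
  · intro w hw z hz h
    simp only [coe_filter, Set.mem_ofPred_eq] at hw hz
    exact eq_of_trunc_eq_of_shift_eq (hw.2.trans hz.2.symm) fun i => congrFun h i

/-- If all segments of the walks in `A` have few parallels, then few walks in `A` pass through
prescribed vertices at the times in `K`. -/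
theorem card_le_of_segment_bound {N : V → Finset V} {B : ℝ} (hB : 0 ≤ B) {x : V} (k : ℕ) :
    ∀ (s : ℕ) (y : V) (K : Finset ℕ) (h : ℕ → V) (A : Finset (ℕ → V)), 1 ≤ s → K ⊆ Ioo 0 s →
      K.card = k → A ⊆ outWalks N x s → (∀ w ∈ A, w s = y) → (∀ w ∈ A, ∀ κ ∈ K, w κ = h κ) →
      (∀ w ∈ A, ∀ a b, a < b → b ≤ s → (b - a < s ∨ K = ∅) →
        (walkCount N (b - a) (w a) (w b) : ℝ) ≤ B ^ (b - a - 1)) →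
      (A.card : ℝ) ≤ B ^ (s - 1 - k) := by
  induction k with
  | zero =>
    intro s y K h A hs hK hk hA hy hh hseg
    rcases A.eq_empty_or_nonempty with rfl | ⟨w, hw⟩
    · simp only [card_empty, Nat.cast_zero]; positivity
    · have h1 := hseg w hw 0 s (by omega) le_rfl (Or.inr (card_eq_zero.1 hk))
      have hx : w 0 = x := (mem_outWalks.1 (hA hw)).2.1
      rw [hx, hy w hw] at h1
      refine le_trans ?_ h1
      rw [Nat.cast_le, walkCount]
      refine card_le_card fun z hz => mem_filter.2 ⟨hA hz, hy z hz⟩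
  | succ k ih =>
    intro s y K h A hs hK hk hA hy hh hseg
    rcases A.eq_empty_or_nonempty with rfl | ⟨w₀, hw₀⟩
    · simp only [card_empty, Nat.cast_zero]; positivity
    have hne : K.Nonempty := card_pos.1 (by omega)
    set κ := K.max' hne with hκ
    have hκK : κ ∈ K := K.max'_mem hne
    have hκs := mem_Ioo.1 (hK hκK)
    have hK' : K.erase κ ⊆ Ioo 0 κ := by
      intro j hj
      rw [mem_erase] at hj
      have := mem_Ioo.1 (hK hj.2)
      exact mem_Ioo.2 ⟨this.1, lt_of_le_of_ne (K.le_max' j hj.2) hj.1⟩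
    have hkκ : k + 1 ≤ κ := by
      have h1 := card_le_card hK'
      rw [card_erase_of_mem hκK, Nat.card_Ioo] at h1
      omega
    have hA' := ih κ (h κ) (K.erase κ) h (A.image (trunc κ)) (by omega) hK'
      (by rw [card_erase_of_mem hκK]; omega)
      (by
        intro z hz
        obtain ⟨w, hw, rfl⟩ := mem_image.1 hz
        exact trunc_mem_outWalks hκs.2.le (hA hw))
      (by
        intro z hz
        obtain ⟨w, hw, rfl⟩ := mem_image.1 hz
        rw [trunc_apply _ le_rfl]; exact hh w hw κ hκK)
      (by
        intro z hz j hj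
        obtain ⟨w, hw, rfl⟩ := mem_image.1 hz
        rw [trunc_apply _ (mem_Ioo.1 (hK' hj)).2.le]
        exact hh w hw j (mem_of_mem_erase hj))
      (by
        intro z hz a b hab hb _
        obtain ⟨w, hw, rfl⟩ := mem_image.1 hz
        rw [trunc_apply _ (by omega), trunc_apply _ hb]
        exact hseg w hw a b hab (by omega) (Or.inl (by omega)))
    have hseg' := hseg w₀ hw₀ κ s hκs.2 le_rfl (Or.inl (by omega))
    rw [hy w₀ hw₀, hh w₀ hw₀ κ hκK] at hseg'
    have h1 : (A.card : ℝ) ≤ B ^ (s - κ - 1) * (A.image (trunc κ)).card := by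
      refine card_le_mul_card_of_fibers (trunc κ) (fun w hw => mem_image_of_mem _ hw) ?_
      intro w' _
      refine le_trans ?_ hseg'
      exact_mod_cast card_fiber_trunc_le_walkCount hκs.2.le A hA hy (fun w hw => hh w hw κ hκK) w'
    calc (A.card : ℝ) ≤ B ^ (s - κ - 1) * (A.image (trunc κ)).card := h1
      _ ≤ B ^ (s - κ - 1) * B ^ (κ - 1 - k) := by gcongr
      _ = B ^ (s - 1 - (k + 1)) := by rw [← pow_add]; congr 1; omega

/-- The pair `(u, v)` is joined by exceptionally many walks of length `i`. -/
def HeavyPair (N : V → Finset V) (B : ℝ) (i : ℕ) (u v : V) : Prop :=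
  1 < walkCount N i u v ∧ B ^ (i - 1) / 2 < (walkCount N i u v : ℝ)

theorem walkCount_le_of_not_heavyPair {N : V → Finset V} {B : ℝ} (hB : 1 ≤ B) {i : ℕ} {u v : V}
    (h : ¬ HeavyPair N B i u v) : (walkCount N i u v : ℝ) ≤ B ^ (i - 1) := by
  have h1 : (1 : ℝ) ≤ B ^ (i - 1) := one_le_pow₀ hB
  rw [HeavyPair, not_and_or, not_lt, not_lt] at h
  rcases h with h | h
  · exact le_trans (by exact_mod_cast h) h1
  · linarith

/-- The walks of length `i` from `u` that end in a vertex forming a heavy pair with `u`. -/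
noncomputable def heavyWalks (N : V → Finset V) (B : ℝ) (i : ℕ) (u : V) : Finset (ℕ → V) :=
  (outWalks N u i).filter fun w => HeavyPair N B i u (w i)

theorem walkCount_le_one {N : V → Finset V} {i : ℕ} (hi : i ≤ 1) (u v : V) :
    walkCount N i u v ≤ 1 := by
  rw [walkCount, card_le_one]
  intro w hw z hz
  rw [mem_filter, mem_outWalks] at hw hz
  funext j
  have key : ∀ j, j ≤ i → w j = z j := by
    intro j hj
    rcases Nat.eq_zero_or_pos j with h | h
    · subst h; rw [hw.1.2.1, hz.1.2.1]
    · have : j = i := by omega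
      subst this
      rw [hw.2, hz.2]
  rcases le_total j i with h | h
  · exact key j h
  · rw [mem_seqs.1 hw.1.1 j h, mem_seqs.1 hz.1.1 j h, key i le_rfl]

theorem exists_concentrated {ℓ : ℕ} (hℓ : 2 ≤ ℓ) {N : V → Finset V} {d : ℕ} (hd : 0 < d) {B : ℝ}
    (hB : 2 ≤ B) (hBn : B ^ (ℓ - 1) * Fintype.card V ≤ (d : ℝ) ^ ℓ) {x₀ : V}
    (hx₀ : (d : ℝ) ^ ℓ ≤ (outWalks N x₀ ℓ).card) {θ : ℝ} (hθ : 0 < θ) (hθ1 : θ ≤ 1) :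
    ∃ (t : ℕ) (x : V) (e : ℝ), 2 ≤ t ∧ t ≤ ℓ ∧ θ ^ ℓ / 2 ≤ e ∧ e ≤ 1 ∧
      e * (d : ℝ) ^ t ≤ (heavyWalks N B t x).card ∧
      ∀ i < t, ∀ y, ((heavyWalks N B i y).card : ℝ) ≤ θ * e * (d : ℝ) ^ i := by
  have hdpos : (0 : ℝ) < d := by exact_mod_cast hd
  let conc : ℕ → Prop := fun i => ∃ x, θ ^ (ℓ - i) / 2 * (d : ℝ) ^ i ≤ (heavyWalks N B i x).card
  have hconcℓ : conc ℓ := by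
    refine ⟨x₀, ?_⟩
    have h1 : ((outWalks N x₀ ℓ).card : ℝ) =
        (heavyWalks N B ℓ x₀).card +
          ((outWalks N x₀ ℓ).filter fun w => ¬ HeavyPair N B ℓ x₀ (w ℓ)).card := by
      rw [heavyWalks]
      exact_mod_cast (card_filter_add_card_filter_not _).symm
    have h2 : (((outWalks N x₀ ℓ).filter fun w => ¬ HeavyPair N B ℓ x₀ (w ℓ)).card : ℝ) ≤
        B ^ (ℓ - 1) / 2 * (univ : Finset V).card := by
      refine card_le_mul_card_of_fibers (fun w => w ℓ) (fun _ _ => mem_univ _) fun v _ => ?_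
      by_cases hv : HeavyPair N B ℓ x₀ v
      · rw [filter_false_of_mem]
        · simp only [card_empty, Nat.cast_zero]; positivity
        · intro w hw h
          rw [mem_filter, h] at hw
          exact hw.2 hv
      · have h3 : (((outWalks N x₀ ℓ).filter fun w => ¬ HeavyPair N B ℓ x₀ (w ℓ)).filter
            fun w => w ℓ = v).card ≤ walkCount N ℓ x₀ v := by
          refine card_le_card fun w hw => ?_
          simp only [mem_filter] at hw ⊢
          exact ⟨hw.1.1, hw.2⟩
        refine le_trans (Nat.cast_le.2 h3) ?_
        rw [HeavyPair, not_and_or, not_lt, not_lt] at hv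
        rcases hv with hv | hv
        · have h5 : B ≤ B ^ (ℓ - 1) := le_self_pow₀ (by linarith) (by omega)
          have h6 : (walkCount N ℓ x₀ v : ℝ) ≤ 1 := by exact_mod_cast hv
          linarith
        · exact hv
    rw [card_univ] at h2
    simp only [Nat.sub_self, pow_zero]
    nlinarith
  have hex : ∃ i, conc i := ⟨ℓ, hconcℓ⟩
  set t := Nat.find hex with ht
  obtain ⟨x, hx⟩ := Nat.find_spec hex
  have hpos : ∀ i, 0 < θ ^ (ℓ - i) / 2 * (d : ℝ) ^ i := fun i => by positivity
  have htℓ : t ≤ ℓ := Nat.find_min' hex hconcℓ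
  have ht2 : 2 ≤ t := by
    by_contra! h
    have h0 : heavyWalks N B t x = ∅ := by
      rw [heavyWalks, filter_eq_empty_iff]
      intro w _ hw
      exact absurd hw.1 (not_lt.2 (walkCount_le_one (by omega) _ _))
    have h1 := hpos t
    rw [h0] at hx
    simp only [card_empty, Nat.cast_zero] at hx
    linarith
  refine ⟨t, x, θ ^ (ℓ - t) / 2, ht2, htℓ, ?_, ?_, hx, fun i hi y => ?_⟩
  · have : θ ^ ℓ ≤ θ ^ (ℓ - t) := pow_le_pow_of_le_one hθ.le hθ1 (by omega)
    linarith
  · have : θ ^ (ℓ - t) ≤ 1 := pow_le_one₀ hθ.le hθ1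
    linarith
  · have h1 := Nat.find_min hex hi
    simp only [conc, not_exists, not_le] at h1
    refine (h1 y).le.trans ?_
    have h2 : θ ^ (ℓ - i) ≤ θ * θ ^ (ℓ - t) := by
      rw [← pow_succ']
      exact pow_le_pow_of_le_one hθ.le hθ1 (by omega)
    have h3 : (0 : ℝ) < (d : ℝ) ^ i := by positivity
    nlinarith

end Walks

section Saturation

open scoped Classical

variable {V : Type*}

/-- The `i`-th edge of a sequence of vertices. -/
noncomputable def edge (w : ℕ → V) (i : ℕ) : Finset V := {w i, w (i + 1)}

/-- The edges of a sequence of vertices with indices in `I`. -/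
noncomputable def edges (w : ℕ → V) (I : Finset ℕ) : Finset (Finset V) := I.image (edge w)

theorem edges_congr {w w' : ℕ → V} {I : Finset ℕ} (h : ∀ i ∈ I, w i = w' i ∧ w (i + 1) = w' (i + 1)) :
    edges w I = edges w' I := by
  refine image_congr fun i hi => ?_
  rw [edge, edge, (h i hi).1, (h i hi).2]

theorem edges_trunc {a : ℕ} (w : ℕ → V) {I : Finset ℕ} (h : ∀ i ∈ I, i < a) :
    edges (trunc a w) I = edges w I :=
  edges_congr fun i hi => ⟨trunc_apply _ (h i hi).le, trunc_apply _ (h i hi)⟩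

/-- The edges with indices in `I` are saturated, and no proper subfamily of `I` has this property. -/
def MinSat (Sat : Finset (Finset V) → Prop) (w : ℕ → V) (I : Finset ℕ) : Prop :=
  Sat (edges w I) ∧ ∀ J ⊂ I, ¬ Sat (edges w J)

theorem exists_minSat {Sat : Finset (Finset V) → Prop} {w : ℕ → V} {J : Finset ℕ}
    {S : Finset (Finset V)} (hS : S ⊆ edges w J) (hSat : Sat S) : ∃ I ⊆ J, MinSat Sat w I := by
  obtain ⟨I₀, hI₀, rfl⟩ := Finset.subset_image_iff.1 hS
  have hI₀' : I₀ ⊆ J := by exact_mod_cast hI₀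
  induction I₀ using Finset.strongInduction with
  | H I ih =>
    by_cases h : ∃ J ⊂ I, Sat (edges w J)
    · obtain ⟨J', hJ', hs⟩ := h
      have hsub := hJ'.1.trans hI₀'
      exact ih J' hJ' (by exact_mod_cast hsub) (image_subset_image hsub) hs hsub
    · push Not at h
      exact ⟨I, hI₀', hSat, h⟩

theorem MinSat.notMem_erase {Sat : Finset (Finset V) → Prop} {w : ℕ → V} {I : Finset ℕ}
    (h : MinSat Sat w I) {i : ℕ} (hi : i ∈ I) : edge w i ∉ edges w (I.erase i) := by
  intro hmem
  refine h.2 _ (erase_ssubset hi) ?_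
  have : edges w (I.erase i) = edges w I := by
    conv_rhs => rw [← insert_erase hi, edges, image_insert]
    exact (insert_eq_self.2 hmem).symm
  rw [this]; exact h.1

theorem MinSat.injOn {Sat : Finset (Finset V) → Prop} {w : ℕ → V} {I : Finset ℕ}
    (h : MinSat Sat w I) : Set.InjOn (edge w) I := by
  intro i hi j hj hij
  by_contra hne
  refine h.notMem_erase hi ?_
  rw [hij]
  exact mem_image_of_mem _ (mem_erase.2 ⟨fun h => hne h.symm, hj⟩)

theorem MinSat.disjoint_edges {Sat : Finset (Finset V) → Prop} {w : ℕ → V} {I J K : Finset ℕ}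
    (h : MinSat Sat w I) (hJ : J ⊆ I) (hK : K ⊆ I) (hJK : Disjoint J K) :
    Disjoint (edges w J) (edges w K) := by
  rw [disjoint_left]
  intro e he he'
  obtain ⟨i, hi, rfl⟩ := mem_image.1 he
  obtain ⟨j, hj, hij⟩ := mem_image.1 he'
  have := h.injOn (hK hj) (hJ hi) hij
  subst this
  exact disjoint_left.1 hJK hi hj

theorem MinSat.card_edges {Sat : Finset (Finset V) → Prop} {w : ℕ → V} {I J : Finset ℕ}
    (h : MinSat Sat w I) (hJ : J ⊆ I) : (edges w J).card = J.card :=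
  card_image_of_injOn (h.injOn.mono (by exact_mod_cast hJ))

/-- Every nonempty unsaturated set has at most `ε * B ^ j` saturated extensions by `j` edges. -/
def LinkBound (Sat : Finset (Finset V) → Prop) (ε B : ℝ) : Prop :=
  ∀ S : Finset (Finset V), S.Nonempty → ¬ Sat S → ∀ j : ℕ, 1 ≤ j →
    ∀ 𝒰 : Finset (Finset (Finset V)),
      (∀ U ∈ 𝒰, U.card = j ∧ Disjoint S U ∧ Sat (S ∪ U)) → (𝒰.card : ℝ) ≤ ε * B ^ j

variable [Fintype V]

/-- The choices for the next vertex which complete the edges with indices in `I.erase i` to a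
saturated set. -/
noncomputable def linkStep (Sat : Finset (Finset V) → Prop) (I : Finset ℕ) (i : ℕ) (w : ℕ → V) :
    Finset V :=
  univ.filter fun y => (edges w (I.erase i)).Nonempty ∧ ¬ Sat (edges w (I.erase i)) ∧
    {w i, y} ∉ edges w (I.erase i) ∧ Sat (insert {w i, y} (edges w (I.erase i)))

theorem card_linkStep_le {Sat : Finset (Finset V) → Prop} {ε B : ℝ} (hL : LinkBound Sat ε B)
    (hε : 0 ≤ ε) (hB : 0 ≤ B) (I : Finset ℕ) (i : ℕ) (w : ℕ → V) :
    ((linkStep Sat I i w).card : ℝ) ≤ ε * B := by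
  rcases (linkStep Sat I i w).eq_empty_or_nonempty with h | ⟨y, hy⟩
  · rw [h]; simp only [card_empty, Nat.cast_zero]; positivity
  · obtain ⟨h1, h2, -⟩ := (mem_filter.1 hy).2
    have h3 := hL _ h1 h2 1 le_rfl ((linkStep Sat I i w).image fun y => {{w i, y}}) (by
      intro U hU
      obtain ⟨z, hz, rfl⟩ := mem_image.1 hU
      obtain ⟨-, -, h3, h4⟩ := (mem_filter.1 hz).2
      refine ⟨card_singleton _, disjoint_singleton_right.2 h3, ?_⟩
      rwa [union_comm, ← insert_eq])
    rw [card_image_of_injective, pow_one] at h3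
    · exact h3
    · intro y z hyz
      have h5 : ({w i, y} : Finset V) = {w i, z} := by simpa using hyz
      have h6 : y ∈ ({w i, z} : Finset V) := by rw [← h5]; simp
      have h7 : z ∈ ({w i, y} : Finset V) := by rw [h5]; simp
      simp only [mem_insert, mem_singleton] at h6 h7
      rcases h6 with h6 | h6
      · rcases h7 with h7 | h7
        · rw [h6, h7]
        · exact h7.symm
      · exact h6

theorem MinSat.mem_linkStep {Sat : Finset (Finset V) → Prop} {w : ℕ → V} {I : Finset ℕ}
    (h : MinSat Sat w I) {i : ℕ} (hi : i ∈ I) (hne : (I.erase i).Nonempty)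
    (hlast : ∀ j ∈ I, j ≤ i) : w (i + 1) ∈ linkStep Sat I i (trunc i w) := by
  have h1 : edges (trunc i w) (I.erase i) = edges w (I.erase i) :=
    edges_trunc _ fun j hj => lt_of_le_of_ne (hlast j (mem_of_mem_erase hj)) (ne_of_mem_erase hj)
  rw [linkStep, h1, mem_filter, trunc_apply _ le_rfl]
  refine ⟨mem_univ _, hne.image _, h.2 _ (erase_ssubset hi), h.notMem_erase hi, ?_⟩
  have : insert {w i, w (i + 1)} (edges w (I.erase i)) = edges w I := by
    conv_rhs => rw [← insert_erase hi, edges, image_insert]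
    rfl
  rw [this]; exact h.1

/-- Discarding features of small weight: one can pass to a subset `T'` of the features such that
every remaining feature `b` is still used by at least `c b` elements of `P`. -/
theorem exists_cleaned {α β : Type*} [DecidableEq β] (P : Finset α) (T : Finset β) (φ : α → Finset β)
    (hφ : ∀ a ∈ P, φ a ⊆ T) (c : β → ℝ) (hc : ∀ b, 0 ≤ c b) :
    ∃ T' ⊆ T, (P.card : ℝ) - ∑ b ∈ T, c b ≤ (P.filter fun a => φ a ⊆ T').card ∧
      ∀ b ∈ T', c b ≤ ((P.filter fun a => φ a ⊆ T').filter fun a => b ∈ φ a).card := by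
  obtain ⟨T', hT', hmax⟩ := exists_max_image T.powerset
    (fun T' => ((P.filter fun a => φ a ⊆ T').card : ℝ) - ∑ b ∈ T', c b) ⟨T, mem_powerset_self T⟩
  rw [mem_powerset] at hT'
  refine ⟨T', hT', ?_, fun b hb => ?_⟩
  · have h1 := hmax T (mem_powerset_self T)
    rw [filter_true_of_mem hφ] at h1
    have h2 : 0 ≤ ∑ b ∈ T', c b := sum_nonneg fun b _ => hc b
    linarith
  · have h1 := hmax (T'.erase b) (mem_powerset.2 ((erase_subset _ _).trans hT'))
    rw [← add_sum_erase _ _ hb] at h1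
    have h2 : (P.filter fun a => φ a ⊆ T').card ≤ (P.filter fun a => φ a ⊆ T'.erase b).card +
        ((P.filter fun a => φ a ⊆ T').filter fun a => b ∈ φ a).card := by
      refine (card_le_card ?_).trans (card_union_le _ _)
      intro a ha
      rw [mem_union, mem_filter, mem_filter]
      by_cases hba : b ∈ φ a
      · exact Or.inr ⟨ha, hba⟩
      · exact Or.inl ⟨(mem_filter.1 ha).1, subset_erase.2 ⟨(mem_filter.1 ha).2, hba⟩⟩
    have h3 : ((P.filter fun a => φ a ⊆ T').card : ℝ) ≤ (P.filter fun a => φ a ⊆ T'.erase b).card +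
        ((P.filter fun a => φ a ⊆ T').filter fun a => b ∈ φ a).card := by exact_mod_cast h2
    linarith

end Saturation

section GoodWalks

open scoped Classical

variable {V : Type*} [Fintype V]

theorem card_fiber_trunc_le {V : Type*} {a : ℕ} {M : ℝ}
    (A : Finset (ℕ → V)) (T : V → Finset (ℕ → V))
    (hT : ∀ y, ((T y).card : ℝ) ≤ M) (hAT : ∀ w ∈ A, (fun i => w (a + i)) ∈ T (w a)) :
    (A.card : ℝ) ≤ M * (A.image (trunc a)).card := by
  refine card_le_mul_card_of_fibers (trunc a) (fun w hw => mem_image_of_mem _ hw) fun w' _ => ?_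
  refine le_trans (Nat.cast_le.2 ?_) (hT (w' a))
  refine Finset.card_le_card_of_injOn (fun w i => w (a + i)) ?_ ?_
  · intro w hw
    obtain ⟨hw1, hw2⟩ := mem_filter.1 (mem_coe.1 hw)
    have := hAT w hw1
    rw [← trunc_apply w le_rfl, hw2] at this
    exact this
  · intro w hw z hz h
    obtain ⟨hw1, hw2⟩ := mem_filter.1 (mem_coe.1 hw)
    obtain ⟨hz1, hz2⟩ := mem_filter.1 (mem_coe.1 hz)
    exact eq_of_trunc_eq_of_shift_eq (hw2.trans hz2.symm) fun i => congrFun h i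

theorem card_heavySegment_le {N : V → Finset V} {d : ℕ} (hN : ∀ v, (N v).card ≤ d) {B : ℝ}
    (x : V) {a i L : ℕ} (hL : a + i ≤ L) {M : ℝ}
    (hM : ∀ y, ((heavyWalks N B i y).card : ℝ) ≤ M * (d : ℝ) ^ i) :
    (((outWalks N x L).filter fun w => HeavyPair N B i (w a) (w (a + i))).card : ℝ) ≤
      M * (d : ℝ) ^ L := by
  set A := (outWalks N x L).filter fun w => HeavyPair N B i (w a) (w (a + i)) with hA
  have hM0 : 0 ≤ M * (d : ℝ) ^ i := (Nat.cast_nonneg _).trans (hM x)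
  have h1 : (A.card : ℝ) ≤ (d : ℝ) ^ (L - (a + i)) * (A.image (trunc (a + i))).card := by
    refine card_fiber_trunc_le A
      (fun y => outWalks N y (L - (a + i))) (fun y => card_outWalks_le hN y _) fun w hw => ?_
    refine shift_mem_outWalks (x := x) ?_
    rw [Nat.add_sub_cancel' hL]; exact (mem_filter.1 hw).1
  have h2 : ((A.image (trunc (a + i))).card : ℝ) ≤
      M * (d : ℝ) ^ i * ((A.image (trunc (a + i))).image (trunc a)).card := by
    refine card_fiber_trunc_le _ (fun y => heavyWalks N B i y) hM fun w hw => ?_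
    obtain ⟨z, hz, rfl⟩ := mem_image.1 hw
    obtain ⟨hz1, hz2⟩ := mem_filter.1 hz
    rw [heavyWalks, mem_filter]
    refine ⟨shift_mem_outWalks (trunc_mem_outWalks hL hz1), ?_⟩
    dsimp only
    rw [trunc_apply _ (by omega), trunc_apply _ le_rfl]
    exact hz2
  have h3 : (((A.image (trunc (a + i))).image (trunc a)).card : ℝ) ≤ (d : ℝ) ^ a := by
    refine le_trans (Nat.cast_le.2 (card_le_card ?_)) (card_outWalks_le hN x a)
    intro w hw
    obtain ⟨y, hy, rfl⟩ := mem_image.1 hw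
    obtain ⟨z, hz, rfl⟩ := mem_image.1 hy
    rw [trunc_trunc _ (Nat.le_add_right a i)]
    exact trunc_mem_outWalks (show a ≤ L by omega) (mem_filter.1 hz).1
  calc (A.card : ℝ) ≤ _ := h1
    _ ≤ (d : ℝ) ^ (L - (a + i)) * (M * (d : ℝ) ^ i * (d : ℝ) ^ a) := by
        gcongr
        exact h2.trans (mul_le_mul_of_nonneg_left h3 hM0)
    _ = M * ((d : ℝ) ^ (L - (a + i)) * (d : ℝ) ^ i * (d : ℝ) ^ a) := by ring
    _ = M * (d : ℝ) ^ L := by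
        rw [← pow_add, ← pow_add]; congr 2; omega

theorem card_coincidence_le {N : V → Finset V} {d : ℕ} (hN : ∀ v, (N v).card ≤ d)
    (x : V) {i j L : ℕ} (hij : i ≤ j) (hL : j < L) :
    (((outWalks N x L).filter fun w => w (j + 1) = w i).card : ℝ) * d ≤ (d : ℝ) ^ L := by
  have := card_filter_extensions_mul_le {fun _ => x} (σ := fun i w => N (w i)) (Nat.zero_le j) hL
    (a := fun _ => (d : ℝ)) (fun i _ _ w => by exact_mod_cast hN (w i))
    ((outWalks N x L).filter fun w => w (j + 1) = w i) (filter_subset _ _) (fun w => {w i})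
    (s := 1) (fun w => by simp) (by
      intro w hw
      rw [trunc_apply _ hij, mem_singleton]
      exact (mem_filter.1 hw).2) (Nat.cast_nonneg _)
  simpa using this

theorem card_minSat_le {N : V → Finset V} {d : ℕ} (hN : ∀ v, (N v).card ≤ d)
    {Sat : Finset (Finset V) → Prop} {ε B : ℝ} (hLink : LinkBound Sat ε B) (hε : 0 ≤ ε)
    (hB : 0 ≤ B) (h0 : ¬ Sat ∅) (h1 : ∀ u v, v ∈ N u → ¬ Sat {{u, v}})
    (x : V) {L : ℕ} (I : Finset ℕ) (hI : I ⊆ range L) :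
    (((outWalks N x L).filter fun w => MinSat Sat w I).card : ℝ) * d ≤ ε * B * (d : ℝ) ^ L := by
  rcases I.eq_empty_or_nonempty with rfl | hne
  · rw [filter_false_of_mem fun w _ h => h0 h.1]
    simp only [card_empty, Nat.cast_zero, zero_mul]; positivity
  set i := I.max' hne with hi
  have hiI : i ∈ I := I.max'_mem hne
  have := card_filter_extensions_mul_le {fun _ => x} (σ := fun i w => N (w i)) (Nat.zero_le i)
    (mem_range.1 (hI hiI))
    (a := fun _ => (d : ℝ)) (fun i _ _ w => by exact_mod_cast hN (w i))
    ((outWalks N x L).filter fun w => MinSat Sat w I) (filter_subset _ _) (linkStep Sat I i)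
    (s := ε * B) (card_linkStep_le hLink hε hB I i) (by
      intro w hw
      obtain ⟨hw1, hw2⟩ := mem_filter.1 hw
      refine hw2.mem_linkStep hiI ?_ fun j hj => I.le_max' j hj
      by_contra hemp
      rw [not_nonempty_iff_eq_empty] at hemp
      have hIi : I = {i} := by rw [← insert_erase hiI, hemp]; rfl
      have h2 := hw2.1
      rw [hIi, edges, image_singleton] at h2
      exact h1 _ _ ((mem_outWalks.1 hw1).2.2 i (mem_range.1 (hI hiI))) h2) (Nat.cast_nonneg _)
  simpa using this

/-- A walk along distinct vertices that contains no saturated set of edges. -/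
def GoodWalk (Sat : Finset (Finset V) → Prop) (L : ℕ) (w : ℕ → V) : Prop :=
  Set.InjOn w (Set.Iic L) ∧ ∀ S ⊆ edges w (range L), ¬ Sat S

/-- Most walks with heavy ends are good and have no heavy proper segments. -/
theorem card_good_heavyWalks_ge {N : V → Finset V} {d : ℕ} (hd : 0 < d)
    (hN : ∀ v, (N v).card ≤ d)
    {Sat : Finset (Finset V) → Prop} {ε B : ℝ} (hLink : LinkBound Sat ε B) (hε : 0 ≤ ε)
    (hB : 0 ≤ B) (hBd : B ≤ d) (h0 : ¬ Sat ∅) (h1 : ∀ u v, v ∈ N u → ¬ Sat {{u, v}})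
    {x : V} {t : ℕ} (ht : 0 < t) {e θ : ℝ} (he : e * (d : ℝ) ^ t ≤ (heavyWalks N B t x).card)
    (hθ : ∀ i < t, ∀ y, ((heavyWalks N B i y).card : ℝ) ≤ θ * e * (d : ℝ) ^ i) :
    (e - ((t + 1) ^ 2 * (θ * e) + (t + 1) ^ 2 / d + 2 ^ t * ε)) * (d : ℝ) ^ t ≤
      ((heavyWalks N B t x).filter fun w => GoodWalk Sat t w ∧
        ∀ a b, a < b → b ≤ t → b - a < t → ¬ HeavyPair N B (b - a) (w a) (w b)).card := by
  have hd' : (0 : ℝ) < d := by exact_mod_cast hd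
  set G := (heavyWalks N B t x).filter fun w => GoodWalk Sat t w ∧
        ∀ a b, a < b → b ≤ t → b - a < t → ¬ HeavyPair N B (b - a) (w a) (w b) with hG
  let bad1 := (range (t + 1) ×ˢ range (t + 1)).biUnion fun p =>
    if p.1 + p.2 ≤ t ∧ p.2 < t then
      (outWalks N x t).filter fun w => HeavyPair N B p.2 (w p.1) (w (p.1 + p.2)) else ∅
  let bad2 := (range (t + 1) ×ˢ range (t + 1)).biUnion fun p =>
    if p.1 ≤ p.2 ∧ p.2 < t then
      (outWalks N x t).filter fun w => w (p.2 + 1) = w p.1 else ∅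
  let bad3 := (range t).powerset.biUnion fun I => (outWalks N x t).filter fun w => MinSat Sat w I
  have hθe : 0 ≤ θ * e * (d : ℝ) ^ t := by
    have := (Nat.cast_nonneg _).trans (hθ 0 ht x)
    rw [pow_zero, mul_one] at this
    positivity
  have hb1 : (bad1.card : ℝ) ≤ (t + 1) ^ 2 * (θ * e) * (d : ℝ) ^ t := by
    have h : (bad1.card : ℝ) ≤ ∑ p ∈ range (t + 1) ×ˢ range (t + 1), θ * e * (d : ℝ) ^ t := by
      refine (Nat.cast_le.2 card_biUnion_le).trans ?_
      push_cast
      refine sum_le_sum fun p _ => ?_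
      split_ifs with hp
      · exact card_heavySegment_le hN x hp.1 (hθ p.2 hp.2)
      · simpa using hθe
    refine h.trans (le_of_eq ?_)
    rw [sum_const, card_product, card_range, nsmul_eq_mul]
    push_cast
    ring
  have hb2 : (bad2.card : ℝ) ≤ (t + 1) ^ 2 / d * (d : ℝ) ^ t := by
    have h : (bad2.card : ℝ) ≤ ∑ p ∈ range (t + 1) ×ˢ range (t + 1), (d : ℝ) ^ t / d := by
      refine (Nat.cast_le.2 card_biUnion_le).trans ?_
      push_cast
      refine sum_le_sum fun p _ => ?_
      split_ifs with hp
      · rw [le_div_iff₀ hd']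
        exact card_coincidence_le hN x hp.1 hp.2
      · simp only [card_empty, Nat.cast_zero]; positivity
    refine h.trans (le_of_eq ?_)
    rw [sum_const, card_product, card_range, nsmul_eq_mul]
    push_cast
    ring
  have hb3 : (bad3.card : ℝ) ≤ 2 ^ t * ε * (d : ℝ) ^ t := by
    have h : (bad3.card : ℝ) ≤ ∑ p ∈ (range t).powerset, ε * (d : ℝ) ^ t := by
      refine (Nat.cast_le.2 card_biUnion_le).trans ?_
      push_cast
      refine sum_le_sum fun I hI => ?_
      have h2 := card_minSat_le hN hLink hε hB h0 h1 x I (mem_powerset.1 hI)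
      have h3 : ε * B * (d : ℝ) ^ t ≤ ε * (d : ℝ) ^ t * d := by
        have : ε * (d : ℝ) ^ t * B ≤ ε * (d : ℝ) ^ t * d :=
          mul_le_mul_of_nonneg_left hBd (by positivity)
        linarith
      exact le_of_mul_le_mul_right (h2.trans h3) hd'
    refine h.trans (le_of_eq ?_)
    rw [sum_const, card_powerset, card_range, nsmul_eq_mul]
    push_cast
    ring
  have hcover : heavyWalks N B t x ⊆ G ∪ (bad1 ∪ (bad2 ∪ bad3)) := by
    intro w hw
    by_contra hnot
    simp only [mem_union, not_or] at hnot
    obtain ⟨n0, n1, n2, n3⟩ := hnot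
    have hwo : w ∈ outWalks N x t := (mem_filter.1 hw).1
    refine n0 (mem_filter.2 ⟨hw, ⟨?_, ?_⟩, ?_⟩)
    · have key : ∀ i j, i < j → j ≤ t → w i ≠ w j := by
        intro i j hij hj he
        refine n2 (mem_biUnion.2 ⟨(i, j - 1), ?_, ?_⟩)
        · rw [mem_product, mem_range, mem_range]; dsimp only; omega
        · dsimp only
          rw [if_pos (by omega), mem_filter, Nat.sub_add_cancel (by omega)]
          exact ⟨hwo, he.symm⟩
      intro i hi j hj hij
      rcases lt_trichotomy i j with h | h | h
      · exact absurd hij (key i j h hj)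
      · exact h
      · exact absurd hij.symm (key j i h hi)
    · intro S hS hSat
      obtain ⟨I, hI, hm⟩ := exists_minSat hS hSat
      exact n3 (mem_biUnion.2 ⟨I, mem_powerset.2 hI, mem_filter.2 ⟨hwo, hm⟩⟩)
    · intro a b hab hb hba hh
      refine n1 (mem_biUnion.2 ⟨(a, b - a), ?_, ?_⟩)
      · rw [mem_product, mem_range, mem_range]; dsimp only; omega
      · dsimp only
        rw [if_pos (by omega), mem_filter, Nat.add_sub_cancel' hab.le]
        exact ⟨hwo, hh⟩
  have hcard : ((heavyWalks N B t x).card : ℝ) ≤ G.card + (bad1.card + (bad2.card + bad3.card)) := by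
    have h1 := card_le_card hcover
    have h2 := card_union_le G (bad1 ∪ (bad2 ∪ bad3))
    have h3 := card_union_le bad1 (bad2 ∪ bad3)
    have h4 := card_union_le bad2 bad3
    exact_mod_cast (by omega : (heavyWalks N B t x).card ≤ G.card + (bad1.card + (bad2.card + bad3.card)))
  linarith

end GoodWalks

section Frames

open scoped Classical

variable {V : Type*} [Fintype V]

/-- A collection of good walks `out` of length `t` from `x` ending in a set `top`, in which every
vertex of `top` has `b` back-neighbours in a set `mid` and is the end of `q` well-spread walks from
`x`, and every vertex of `mid` has many out-neighbours in `top`. -/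
structure Frame (N : V → Finset V) (Sat : Finset (Finset V) → Prop) (B γ : ℝ) (d t b q : ℕ)
    (x : V) where
  top : Finset V
  mid : Finset V
  back : V → Finset V
  out : Finset (ℕ → V)
  ret : V → Finset (ℕ → V)
  out_subset : out ⊆ outWalks N x t
  out_good : ∀ w ∈ out, GoodWalk Sat t w
  out_top : ∀ w ∈ out, w t ∈ top
  le_card_out : γ * (d : ℝ) ^ t ≤ out.card
  ret_subset : ∀ v, ret v ⊆ outWalks N x t
  ret_good : ∀ v, ∀ w ∈ ret v, GoodWalk Sat t w
  ret_end : ∀ v, ∀ w ∈ ret v, w t = v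
  ret_spread : ∀ (v : V) (K : Finset ℕ) (h : ℕ → V), K ⊆ Ioo 0 t → K.Nonempty →
    (((ret v).filter fun w => ∀ κ ∈ K, w κ = h κ).card : ℝ) ≤ B ^ (t - 1 - K.card)
  card_ret_le : ∀ v, (ret v).card ≤ q
  card_ret : ∀ v ∈ top, (ret v).card = q
  card_back_le : ∀ v, (back v).card ≤ b
  card_back : ∀ v ∈ top, (back v).card = b
  adj_of_mem_back : ∀ v, ∀ u ∈ back v, v ∈ N u
  mid_of_mem_back : ∀ v, ∀ u ∈ back v, u ∈ mid
  le_card_mid : ∀ u ∈ mid, γ * d ≤ (N u ∩ top).card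

theorem sum_walkCount_le {N : V → Finset V} {d : ℕ} (hN : ∀ v, (N v).card ≤ d) (x : V) (i : ℕ)
    (T : Finset V) : ∑ v ∈ T, (walkCount N i x v : ℝ) ≤ (d : ℝ) ^ i := by
  refine le_trans ?_ (card_outWalks_le hN x i)
  rw [card_eq_sum_card_fiberwise (f := fun w : ℕ → V => w i) (t := univ) fun _ _ => mem_univ _]
  push_cast
  exact sum_le_sum_of_subset_of_nonneg (subset_univ _) fun _ _ _ => Nat.cast_nonneg _

theorem card_filter_penultimate_le {N : V → Finset V} {x u : V} {t : ℕ} (ht : 1 ≤ t)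
    (A : Finset (ℕ → V)) (hA : A ⊆ outWalks N x t) (T : Finset V) (hT : ∀ w ∈ A, w t ∈ T)
    (hu : ∀ w ∈ A, w (t - 1) = u) :
    A.card ≤ walkCount N (t - 1) x u * (N u ∩ T).card := by
  rw [walkCount, ← card_product]
  refine Finset.card_le_card_of_injOn (fun w => (trunc (t - 1) w, w t)) ?_ ?_
  · intro w hw
    have hw : w ∈ A := hw
    rw [mem_coe, mem_product, mem_filter, mem_inter]
    refine ⟨⟨trunc_mem_outWalks (by omega) (hA hw), ?_⟩, ?_, hT w hw⟩
    · dsimp only; rw [trunc_apply _ le_rfl, hu w hw]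
    · have := (mem_outWalks.1 (hA hw)).2.2 (t - 1) (by omega)
      rw [Nat.sub_add_cancel ht, hu w hw] at this
      exact this
  · intro w hw z hz h
    obtain ⟨h1, h2⟩ := Prod.mk.inj h
    have hw' := (mem_outWalks.1 (hA hw)).1
    have hz' := (mem_outWalks.1 (hA hz)).1
    have key : ∀ i, i ≤ t → w i = z i := by
      intro i hi
      rcases Nat.lt_or_ge i t with h | h
      · rw [← trunc_apply w (show i ≤ t - 1 by omega), h1, trunc_apply _ (by omega)]
      · rw [show i = t by omega]; exact h2
    funext i
    rcases le_total i t with h | h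
    · exact key i h
    · rw [mem_seqs.1 hw' i h, mem_seqs.1 hz' i h, key t le_rfl]

theorem card_le_mul_card_penultimate {N : V → Finset V} {x v : V} {t : ℕ} (ht : 1 ≤ t) {M : ℝ}
    (A : Finset (ℕ → V)) (hA : A ⊆ outWalks N x t) (hv : ∀ w ∈ A, w t = v)
    (hM : ∀ w ∈ A, (walkCount N (t - 1) x (w (t - 1)) : ℝ) ≤ M) :
    (A.card : ℝ) ≤ M * (A.image fun w => w (t - 1)).card := by
  have hfib : ∀ u ∈ A.image (fun w => w (t - 1)),
      ((A.filter fun w => w (t - 1) = u).card : ℝ) ≤ M := by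
    intro u hu
    obtain ⟨z, hz, rfl⟩ := mem_image.1 hu
    refine le_trans (Nat.cast_le.2 ?_) (hM z hz)
    have h4 := card_filter_penultimate_le (u := z (t - 1)) ht
      (A.filter fun w => w (t - 1) = z (t - 1)) ((filter_subset _ _).trans hA) {v} (by
        intro w hw
        rw [mem_singleton]
        exact hv w (mem_filter.1 hw).1) (fun w hw => (mem_filter.1 hw).2)
    refine h4.trans ?_
    have h5 : (N (z (t - 1)) ∩ {v}).card ≤ 1 :=
      (card_le_card inter_subset_right).trans (card_singleton v).le
    calc _ ≤ walkCount N (t - 1) x (z (t - 1)) * 1 := Nat.mul_le_mul_left _ h5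
      _ = _ := mul_one _
  have hmap : ∀ w ∈ A, (fun w : ℕ → V => w (t - 1)) w ∈ A.image fun w => w (t - 1) :=
    fun w hw => mem_image_of_mem (fun w : ℕ → V => w (t - 1)) hw
  exact card_le_mul_card_of_fibers _ hmap hfib

theorem exists_cleaned_walks {N : V → Finset V} {d : ℕ}
    (hN : ∀ v, (N v).card ≤ d) {B γ : ℝ} (hB : 0 < B) (hγ : 0 < γ)
    {x : V} {t : ℕ} (ht : 2 ≤ t) (P : Finset (ℕ → V)) (hP : P ⊆ heavyWalks N B t x)
    (hcard : 4 * γ * (d : ℝ) ^ t ≤ P.card) :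
    ∃ P' ⊆ P, ∃ mid top : Finset V, (∀ w ∈ P', w (t - 1) ∈ mid ∧ w t ∈ top) ∧
      γ * (d : ℝ) ^ t ≤ P'.card ∧
      (∀ v ∈ top, γ * B ^ (t - 1) ≤ (P'.filter fun w => w t = v).card) ∧
      ∀ u ∈ mid, 0 < walkCount N (t - 1) x u ∧ γ * d * walkCount N (t - 1) x u ≤
        (P'.filter fun w => w (t - 1) = u).card := by
  have hPo : P ⊆ outWalks N x t := hP.trans (filter_subset _ _)
  let U₀ : Finset V := univ.filter fun u => 0 < walkCount N (t - 1) x u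
  let V₀ : Finset V := univ.filter fun v => HeavyPair N B t x v
  let c : V ⊕ V → ℝ := Sum.elim (fun u => γ * d * walkCount N (t - 1) x u)
    (fun _ => γ * B ^ (t - 1))
  let φ : (ℕ → V) → Finset (V ⊕ V) := fun w => {Sum.inl (w (t - 1)), Sum.inr (w t)}
  obtain ⟨T, hT, hT1, hT2⟩ := exists_cleaned P (U₀.disjSum V₀) φ (by
      intro w hw y hy
      simp only [φ, mem_insert, mem_singleton] at hy
      rcases hy with rfl | rfl
      · rw [inl_mem_disjSum, mem_filter]
        refine ⟨mem_univ _, card_pos.2 ⟨trunc (t - 1) w, mem_filter.2 ⟨?_, ?_⟩⟩⟩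
        · exact trunc_mem_outWalks (by omega) (hPo hw)
        · exact trunc_apply _ le_rfl
      · rw [inr_mem_disjSum, mem_filter]
        exact ⟨mem_univ _, (mem_filter.1 (hP hw)).2⟩) c (by
      rintro (u | v)
      · simp only [c, Sum.elim_inl]; positivity
      · simp only [c, Sum.elim_inr]; positivity)
  set P' := P.filter fun w => φ w ⊆ T with hP'
  have hP'P : P' ⊆ P := filter_subset _ _
  have hmem : ∀ w ∈ P', Sum.inl (w (t - 1)) ∈ T ∧ Sum.inr (w t) ∈ T := by
    intro w hw
    have := (mem_filter.1 hw).2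
    exact ⟨this (by simp [φ]), this (by simp [φ])⟩
  have hloss : ∑ y ∈ U₀.disjSum V₀, c y ≤ 3 * γ * (d : ℝ) ^ t := by
    rw [sum_disjSum]
    simp only [c, Sum.elim_inl, Sum.elim_inr]
    have h1 : ∑ u ∈ U₀, γ * d * (walkCount N (t - 1) x u : ℝ) ≤ γ * (d : ℝ) ^ t := by
      rw [← mul_sum]
      calc _ ≤ γ * d * (d : ℝ) ^ (t - 1) := by
            have := sum_walkCount_le hN x (t - 1) U₀
            gcongr
        _ = γ * ((d : ℝ) ^ (t - 1) * d) := by ring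
        _ = _ := by rw [← pow_succ, Nat.sub_add_cancel (by omega)]
    have h2 : ∑ v ∈ V₀, γ * B ^ (t - 1) ≤ 2 * γ * (d : ℝ) ^ t := by
      calc ∑ v ∈ V₀, γ * B ^ (t - 1) ≤ ∑ v ∈ V₀, 2 * γ * (walkCount N t x v : ℝ) := by
            refine sum_le_sum fun v hv => ?_
            have := (mem_filter.1 hv).2.2
            nlinarith
        _ = 2 * γ * ∑ v ∈ V₀, (walkCount N t x v : ℝ) := by rw [mul_sum]
        _ ≤ _ := by
          have := sum_walkCount_le hN x t V₀
          gcongr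
    linarith
  have hV : ∀ v, Sum.inr v ∈ T → γ * B ^ (t - 1) ≤ (P'.filter fun w => w t = v).card := by
    intro v hv
    have h1 : (P'.filter fun w => w t = v) = P'.filter fun w => Sum.inr v ∈ φ w := by
      ext w
      simp only [φ, mem_filter, mem_insert, mem_singleton, reduceCtorEq, Sum.inr.injEq, false_or,
        eq_comm]
    rw [h1]
    exact hT2 _ hv
  have hU : ∀ u, Sum.inl u ∈ T → γ * d * walkCount N (t - 1) x u ≤
      (P'.filter fun w => w (t - 1) = u).card := by
    intro v hv
    have h1 : (P'.filter fun w => w (t - 1) = v) = P'.filter fun w => Sum.inl v ∈ φ w := by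
      ext w
      simp only [φ, mem_filter, mem_insert, mem_singleton, reduceCtorEq, Sum.inl.injEq, or_false,
        eq_comm]
    rw [h1]
    exact hT2 _ hv
  refine ⟨P', hP'P, univ.filter fun v => Sum.inl v ∈ T, univ.filter fun v => Sum.inr v ∈ T,
    fun w hw => ?_, by linarith, fun v hv => hV v (mem_filter.1 hv).2, fun u hu => ?_⟩
  · simpa using hmem w hw
  · have hu' := (mem_filter.1 hu).2
    exact ⟨(mem_filter.1 (inl_mem_disjSum.1 (hT hu'))).2, hU u hu'⟩

theorem exists_frame {N : V → Finset V} {d : ℕ} (hd : 0 < d) (hN : ∀ v, (N v).card ≤ d)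
    {Sat : Finset (Finset V) → Prop} {B γ : ℝ} (hB : 2 ≤ B) (hγ : 0 < γ)
    {x : V} {t : ℕ} (ht : 2 ≤ t) (P : Finset (ℕ → V)) (hP : P ⊆ heavyWalks N B t x)
    (hgood : ∀ w ∈ P, GoodWalk Sat t w)
    (hseg : ∀ w ∈ P, ∀ a b, a < b → b ≤ t → b - a < t → ¬ HeavyPair N B (b - a) (w a) (w b))
    (hcard : 4 * γ * (d : ℝ) ^ t ≤ P.card) :
    Nonempty (Frame N Sat B γ d t ⌈γ * B⌉₊ ⌈γ * B ^ (t - 1)⌉₊ x) := by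
  have hd' : (0 : ℝ) < d := by exact_mod_cast hd
  have hB0 : 0 < B := by linarith
  have hseg' : ∀ w ∈ P, ∀ a b, a < b → b ≤ t → b - a < t →
      (walkCount N (b - a) (w a) (w b) : ℝ) ≤ B ^ (b - a - 1) := fun w hw a b h1 h2 h3 =>
    walkCount_le_of_not_heavyPair (by linarith) (hseg w hw a b h1 h2 h3)
  have hPo : P ⊆ outWalks N x t := hP.trans (filter_subset _ _)
  obtain ⟨P', hP'P, mid, top, hmem, hP'card, hV, hU⟩ := exists_cleaned_walks hN hB0 hγ ht P hP hcard
  have hret : ∀ v, ∃ R ⊆ P'.filter fun w => w t = v, R.card ≤ ⌈γ * B ^ (t - 1)⌉₊ ∧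
      (v ∈ top → R.card = ⌈γ * B ^ (t - 1)⌉₊) := by
    intro v
    by_cases hv : v ∈ top
    · obtain ⟨R, hR, hRc⟩ := exists_subset_card_eq (Nat.ceil_le.2 (hV v hv))
      exact ⟨R, hR, hRc.le, fun _ => hRc⟩
    · exact ⟨∅, empty_subset _, by simp, fun h => absurd h hv⟩
  have hback : ∀ v, ∃ R ⊆ (P'.filter fun w => w t = v).image fun w => w (t - 1),
      R.card ≤ ⌈γ * B⌉₊ ∧ (v ∈ top → R.card = ⌈γ * B⌉₊) := by
    intro v
    by_cases hv : v ∈ top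
    · have h1 := hV v hv
      have h2 : ((P'.filter fun w => w t = v).card : ℝ) ≤
          B ^ (t - 2) * ((P'.filter fun w => w t = v).image fun w => w (t - 1)).card := by
        refine card_le_mul_card_penultimate (N := N) (x := x) (v := v) (by omega) _
          ((filter_subset _ _).trans (hP'P.trans hPo)) (fun w hw => (mem_filter.1 hw).2)
          fun w hw => ?_
        have hwP := (mem_filter.1 hw).1
        have h3 := hseg' w (hP'P hwP) 0 (t - 1) (by omega) (by omega) (by omega)
        rw [(mem_outWalks.1 (hPo (hP'P hwP))).2.1, Nat.sub_zero, Nat.sub_sub] at h3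
        exact h3
      have h6 : γ * B ≤ ((P'.filter fun w => w t = v).image fun w => w (t - 1)).card := by
        have h7 : B ^ (t - 1) = B ^ (t - 2) * B := by
          rw [← pow_succ]; congr 1; omega
        have h8 : (0 : ℝ) < B ^ (t - 2) := by positivity
        rw [h7] at h1
        refine le_of_mul_le_mul_left (le_trans (le_of_eq ?_) (h1.trans h2)) h8
        ring
      obtain ⟨R, hR, hRc⟩ := exists_subset_card_eq (Nat.ceil_le.2 h6)
      exact ⟨R, hR, hRc.le, fun _ => hRc⟩
    · exact ⟨∅, empty_subset _, by simp, fun h => absurd h hv⟩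
  choose ret hret1 hret2 hret3 using hret
  choose back hback1 hback2 hback3 using hback
  have hretP : ∀ v, ∀ w ∈ ret v, w ∈ P ∧ w t = v := fun v w hw =>
    ⟨hP'P (mem_filter.1 (hret1 v hw)).1, (mem_filter.1 (hret1 v hw)).2⟩
  exact ⟨{
    top := top
    mid := mid
    back := back
    out := P'
    ret := ret
    out_subset := hP'P.trans hPo
    out_good := fun w hw => hgood w (hP'P hw)
    out_top := fun w hw => (hmem w hw).2
    le_card_out := hP'card
    ret_subset := fun v w hw => hPo (hretP v w hw).1
    ret_good := fun v w hw => hgood w (hretP v w hw).1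
    ret_end := fun v w hw => (hretP v w hw).2
    ret_spread := by
      intro v K h hK hne
      refine card_le_of_segment_bound (N := N) (x := x) hB0.le K.card t v K h _ (by omega) hK rfl ?_ ?_ ?_ ?_
      · exact fun w hw => hPo (hretP v w (mem_filter.1 hw).1).1
      · exact fun w hw => (hretP v w (mem_filter.1 hw).1).2
      · exact fun w hw => (mem_filter.1 hw).2
      · intro w hw a b h1 h2 h3
        exact hseg' w (hretP v w (mem_filter.1 hw).1).1 a b h1 h2
          (h3.resolve_right hne.ne_empty)
    card_ret_le := hret2
    card_ret := hret3
    card_back_le := hback2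
    card_back := hback3
    adj_of_mem_back := by
      intro v u hu
      obtain ⟨w, hw, rfl⟩ := mem_image.1 (hback1 v hu)
      obtain ⟨hw1, rfl⟩ := mem_filter.1 hw
      have := (mem_outWalks.1 (hPo (hP'P hw1))).2.2 (t - 1) (by omega)
      rwa [Nat.sub_add_cancel (by omega)] at this
    mid_of_mem_back := by
      intro v u hu
      obtain ⟨w, hw, rfl⟩ := mem_image.1 (hback1 v hu)
      exact (hmem w (mem_filter.1 hw).1).1
    le_card_mid := by
      intro u hu
      obtain ⟨hpos, h1⟩ := hU u hu
      have h2 := card_filter_penultimate_le (show 1 ≤ t by omega)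
        (P'.filter fun w => w (t - 1) = u) ((filter_subset _ _).trans (hP'P.trans hPo)) top (by
          intro w hw
          exact (hmem w (mem_filter.1 hw).1).2)
        (fun w hw => (mem_filter.1 hw).2)
      have h3 : (0 : ℝ) < walkCount N (t - 1) x u := by
        exact_mod_cast hpos
      have h4 : ((P'.filter fun w => w (t - 1) = u).card : ℝ) ≤
          walkCount N (t - 1) x u * (N u ∩ top).card := by exact_mod_cast h2
      refine le_of_mul_le_mul_left (le_trans (le_of_eq ?_) (h1.trans h4)) h3
      ring }⟩

end Frames

section FrameCycles

open scoped Classical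

variable {V : Type*} [Fintype V] {N : V → Finset V} {Sat : Finset (Finset V) → Prop}
  {B γ : ℝ} {d t b q : ℕ} {x : V}

/-- The choices for the next vertex when a walk is extended inside a frame, alternating between
`mid` and `top` after time `t`. -/
noncomputable def Frame.step (F : Frame N Sat B γ d t b q x) (i : ℕ) (w : ℕ → V) : Finset V :=
  if i < t then N (w i) else if Even (i - t) then F.back (w i) else N (w i) ∩ F.top

/-- An upper bound for the number of choices at time `i` when extending inside a frame. -/
noncomputable def stepBound (d t b : ℕ) (i : ℕ) : ℝ :=
  if i < t then d else if Even (i - t) then b else d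

/-- The walks of length `m` in a frame which extend a walk in `out`. -/
noncomputable def Frame.outExt (F : Frame N Sat B γ d t b q x) (m : ℕ) : Finset (ℕ → V) :=
  extensions F.out t F.step m

/-- The pairs consisting of a walk of length `m` and a return walk of length `t`. -/
noncomputable def Frame.pairs (F : Frame N Sat B γ d t b q x) (m : ℕ) :
    Finset ((ℕ → V) × (ℕ → V)) :=
  (F.outExt m ×ˢ seqs V t).filter fun p => p.2 ∈ F.ret (p.1 m)

/-- Follow the first walk for `m` steps and then the second one backwards. -/
def closeUp {V : Type*} (m t : ℕ) (p : (ℕ → V) × (ℕ → V)) : ℕ → V :=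
  fun i => if i ≤ m then p.1 i else p.2 (m + t - i)

theorem stepBound_nonneg (d t b i : ℕ) : 0 ≤ stepBound d t b i := by
  rw [stepBound]; split_ifs <;> positivity

theorem le_stepBound {d t b : ℕ} (hb : b ≤ d) (i : ℕ) : (b : ℝ) ≤ stepBound d t b i := by
  rw [stepBound]; split_ifs <;> simp [hb]

theorem prod_stepBound_Ico (d t b : ℕ) (r : ℕ) :
    ∏ i ∈ Ico t (t + 2 * r), stepBound d t b i = ((b : ℝ) * d) ^ r := by
  induction r with
  | zero => simp
  | succ r ih =>
    rw [show t + 2 * (r + 1) = t + 2 * r + 1 + 1 by ring, prod_Ico_succ_top (by omega),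
      prod_Ico_succ_top (by omega), ih]
    have h1 : stepBound d t b (t + 2 * r) = b := by
      rw [stepBound, if_neg (by omega), if_pos]
      rw [Nat.add_sub_cancel_left]; exact even_two_mul r
    have h2 : stepBound d t b (t + 2 * r + 1) = d := by
      rw [stepBound, if_neg (by omega), if_neg]
      rw [Nat.add_assoc, Nat.add_sub_cancel_left]
      simp
    rw [h1, h2]; ring

theorem prod_stepBound_range (d t b : ℕ) : ∏ i ∈ range t, stepBound d t b i = (d : ℝ) ^ t := by
  rw [prod_congr rfl fun i hi => by rw [stepBound, if_pos (mem_range.1 hi)], prod_const, card_range]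

theorem stepBound_last {d t b r m : ℕ} (ht : 1 ≤ t) (hm : m = t + 2 * r) :
    stepBound d t b (m - 1) = d := by
  rw [stepBound]
  split_ifs with h1 h2
  · rfl
  · exfalso
    obtain ⟨k, hk⟩ := h2
    omega
  · rfl

namespace Frame

theorem card_step_le (F : Frame N Sat B γ d t b q x) (hN : ∀ v, (N v).card ≤ d) (i : ℕ)
    (w : ℕ → V) : ((F.step i w).card : ℝ) ≤ stepBound d t b i := by
  rw [step, stepBound]
  split_ifs
  · exact_mod_cast hN _
  · exact_mod_cast F.card_back_le _
  · exact_mod_cast (card_le_card inter_subset_left).trans (hN _)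

theorem outExt_subset (F : Frame N Sat B γ d t b q x) {m : ℕ} :
    F.outExt m ⊆ extensions {fun _ => x} 0 F.step m := by
  intro w hw
  obtain ⟨h1, h2, h3⟩ := mem_extensions.1 hw
  have h4 := mem_outWalks.1 (F.out_subset h2)
  refine mem_extensions.2 ⟨h1, ?_, fun i _ hi => ?_⟩
  · rw [mem_singleton]
    funext i
    have := h4.2.1
    rw [trunc_apply _ (Nat.zero_le _)] at this
    simpa [trunc] using this
  · rcases Nat.lt_or_ge i t with h | h
    · have h5 := h4.2.2 i h
      rw [trunc_apply _ h, trunc_apply _ h.le] at h5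
      rw [step, if_pos h, trunc_apply _ le_rfl]; exact h5
    · exact h3 i h hi

theorem card_outExt_le (F : Frame N Sat B γ d t b q x) (hN : ∀ v, (N v).card ≤ d) (m : ℕ) :
    ((F.outExt m).card : ℝ) ≤ ∏ i ∈ range m, stepBound d t b i := by
  have := card_extensions_le {fun _ => x} (σ := F.step) (Nat.zero_le m)
    (a := stepBound d t b) fun i _ _ w => F.card_step_le hN i w
  rw [card_singleton, Nat.cast_one, one_mul, Nat.Ico_zero_eq_range] at this
  exact (Nat.cast_le.2 (card_le_card F.outExt_subset)).trans this

theorem apply_mem_of_mem_outExt (F : Frame N Sat B γ d t b q x) {m : ℕ} {w : ℕ → V}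
    (hw : w ∈ F.outExt m) {i : ℕ} (hti : t ≤ i) (him : i ≤ m) :
    (Even (i - t) → w i ∈ F.top) ∧ (¬ Even (i - t) → w i ∈ F.mid) := by
  obtain ⟨h1, h2, h3⟩ := mem_extensions.1 hw
  rcases hti.eq_or_lt with rfl | hlt
  · refine ⟨fun _ => ?_, fun h => absurd (by simp) h⟩
    have := F.out_top _ h2
    rwa [trunc_apply _ le_rfl] at this
  · have h4 := h3 (i - 1) (by omega) (by omega)
    have h5 : i - t = i - 1 - t + 1 := by omega
    rw [Nat.sub_add_cancel (by omega), step, if_neg (by omega)] at h4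
    rw [h5, Nat.even_add_one]
    split_ifs at h4 with h6
    · exact ⟨fun h => absurd h6 h, fun _ => F.mid_of_mem_back _ _ h4⟩
    · exact ⟨fun _ => (mem_inter.1 h4).2, fun h => absurd h6 h⟩

theorem le_card_outExt (F : Frame N Sat B γ d t b q x) (hγ : 0 ≤ γ) (hγ1 : γ ≤ 1) {m : ℕ}
    (hm : t ≤ m) :
    γ ^ (m + 1) * ∏ i ∈ range m, stepBound d t b i ≤ (F.outExt m).card := by
  have h1 : (F.out.card : ℝ) * ∏ i ∈ Ico t m, (γ * stepBound d t b i) ≤ (F.outExt m).card := by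
    refine le_card_extensions hm (fun i => mul_nonneg hγ (stepBound_nonneg _ _ _ _))
      (fun w hw => (mem_outWalks.1 (F.out_subset hw)).1) fun i hti him w hw => ?_
    have h2 := F.apply_mem_of_mem_outExt hw hti le_rfl
    rw [step, stepBound, if_neg (not_lt.2 hti), if_neg (not_lt.2 hti)]
    split_ifs with h3
    · rw [F.card_back _ (h2.1 h3)]
      exact mul_le_of_le_one_left (Nat.cast_nonneg _) hγ1
    · exact F.le_card_mid _ (h2.2 h3)
  refine le_trans ?_ h1
  have hpos : 0 ≤ ∏ i ∈ Ico t m, stepBound d t b i :=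
    prod_nonneg fun i _ => stepBound_nonneg _ _ _ _
  rw [prod_mul_distrib, prod_const, Nat.card_Ico, ← prod_range_mul_prod_Ico _ hm,
    prod_stepBound_range]
  calc γ ^ (m + 1) * ((d : ℝ) ^ t * ∏ i ∈ Ico t m, stepBound d t b i)
      ≤ γ ^ (m - t + 1) * ((d : ℝ) ^ t * ∏ i ∈ Ico t m, stepBound d t b i) := by
        refine mul_le_mul_of_nonneg_right ?_ (by positivity)
        exact pow_le_pow_of_le_one hγ hγ1 (by omega)
    _ = γ * (d : ℝ) ^ t * (γ ^ (m - t) * ∏ i ∈ Ico t m, stepBound d t b i) := by ring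
    _ ≤ _ := mul_le_mul_of_nonneg_right F.le_card_out (by positivity)

theorem mem_pairs (F : Frame N Sat B γ d t b q x) {m : ℕ} {p : (ℕ → V) × (ℕ → V)} :
    p ∈ F.pairs m ↔ p.1 ∈ F.outExt m ∧ p.2 ∈ F.ret (p.1 m) := by
  rw [pairs, mem_filter, mem_product]
  exact ⟨fun h => ⟨h.1.1, h.2⟩,
    fun h => ⟨⟨h.1, (mem_outWalks.1 (F.ret_subset _ h.2)).1⟩, h.2⟩⟩

theorem card_pairs (F : Frame N Sat B γ d t b q x) {m r : ℕ} (hm : m = t + 2 * r) :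
    (F.pairs m).card = (F.outExt m).card * q := by
  have h1 : F.pairs m = ((F.outExt m).sigma fun R => F.ret (R m)).map
      (Equiv.sigmaEquivProd (ℕ → V) (ℕ → V)).toEmbedding := by
    ext p
    rw [mem_pairs, mem_map_equiv, mem_sigma]
    rfl
  rw [h1, card_map, card_sigma]
  refine sum_const_nat fun R hR => F.card_ret _ ?_
  refine (F.apply_mem_of_mem_outExt hR (by omega) le_rfl).1 ?_
  rw [hm, Nat.add_sub_cancel_left]; exact even_two_mul r

end Frame

theorem card_le_of_snd_mem {α β : Type*} (A : Finset (α × β)) (T : Finset α)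
    (hT : ∀ p ∈ A, p.1 ∈ T) (E : α → Finset β) (hE : ∀ p ∈ A, p.2 ∈ E p.1) {c : ℝ}
    (hc : ∀ R ∈ T, ((E R).card : ℝ) ≤ c) : (A.card : ℝ) ≤ c * T.card := by
  refine card_le_mul_card_of_fibers Prod.fst hT fun R hR => ?_
  refine le_trans (Nat.cast_le.2 ?_) (hc R hR)
  refine card_le_card_of_injOn Prod.snd ?_ ?_
  · intro p hp
    obtain ⟨h1, h2⟩ := mem_filter.1 hp
    rw [← h2]; exact hE p h1
  · intro p hp p' hp' h
    exact Prod.ext ((mem_filter.1 hp).2.trans (mem_filter.1 hp').2.symm) h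

section Join

variable (F : Frame N Sat B γ d t b q x) {m : ℕ} {p : (ℕ → V) × (ℕ → V)}

theorem closeUp_apply_le {V : Type*} {m t : ℕ} (p : (ℕ → V) × (ℕ → V)) {i : ℕ} (hi : i ≤ m) :
    closeUp m t p i = p.1 i := if_pos hi

theorem Frame.closeUp_apply_ge (hp : p ∈ F.pairs m) {i : ℕ} (hi : m ≤ i) :
    closeUp m t p i = p.2 (m + t - i) := by
  rcases hi.eq_or_lt with rfl | hi
  · rw [closeUp_apply_le p le_rfl, Nat.add_sub_cancel_left, F.ret_end _ _ (F.mem_pairs.1 hp).2]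
  · exact if_neg (by omega)

theorem Frame.closeUp_zero (hp : p ∈ F.pairs m) : closeUp m t p 0 = x := by
  rw [closeUp_apply_le p (Nat.zero_le _)]
  have := (mem_extensions.1 (F.outExt_subset (F.mem_pairs.1 hp).1)).2.1
  rw [mem_singleton] at this
  simpa [trunc] using congrFun this 0

theorem Frame.closeUp_last (hp : p ∈ F.pairs m) : closeUp m t p (m + t) = x := by
  rw [F.closeUp_apply_ge hp (by omega), Nat.sub_self]
  exact (mem_outWalks.1 (F.ret_subset _ (F.mem_pairs.1 hp).2)).2.1

theorem Frame.edge_closeUp_ge (hp : p ∈ F.pairs m) {i : ℕ} (hi : m ≤ i) (hi' : i < m + t) :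
    edge (closeUp m t p) i = edge p.2 (m + t - 1 - i) := by
  rw [edge, edge, F.closeUp_apply_ge hp hi, F.closeUp_apply_ge hp (by omega), pair_comm,
    show m + t - i = m + t - 1 - i + 1 by omega, show m + t - (i + 1) = m + t - 1 - i by omega]

theorem Frame.closeUp_adj (hp : p ∈ F.pairs m) {i : ℕ} (hi : i < m + t) :
    closeUp m t p (i + 1) ∈ N (closeUp m t p i) ∨ closeUp m t p i ∈ N (closeUp m t p (i + 1)) := by
  obtain ⟨h1, h2⟩ := F.mem_pairs.1 hp
  rcases Nat.lt_or_ge i m with h | h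
  · rw [closeUp_apply_le p h, closeUp_apply_le p h.le]
    have h3 := (mem_extensions.1 (F.outExt_subset h1)).2.2 i (Nat.zero_le _) h
    rw [step, trunc_apply _ le_rfl] at h3
    split_ifs at h3
    · exact Or.inl h3
    · exact Or.inr (F.adj_of_mem_back _ _ h3)
    · exact Or.inl (mem_inter.1 h3).1
  · rw [F.closeUp_apply_ge hp h, F.closeUp_apply_ge hp (by omega)]
    right
    have h3 := (mem_outWalks.1 (F.ret_subset _ h2)).2.2 (m + t - (i + 1)) (by omega)
    rwa [show m + t - (i + 1) + 1 = m + t - i by omega] at h3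

theorem Frame.closeUp_one_mem (ht : 1 ≤ t) (htm : t ≤ m) (hp : p ∈ F.pairs m) :
    closeUp m t p 1 ∈ N x := by
  have h1 := (F.mem_pairs.1 hp).1
  have h3 := (mem_extensions.1 (F.outExt_subset h1)).2.2 0 (Nat.zero_le _) (by omega)
  rw [step, if_pos (by omega), trunc_apply _ le_rfl] at h3
  have h0 := F.closeUp_zero hp
  rw [closeUp_apply_le p (by omega)] at h0
  rw [h0] at h3
  rw [closeUp_apply_le p (by omega)]; exact h3

theorem Frame.closeUp_penultimate_mem (ht : 1 ≤ t) (hp : p ∈ F.pairs m) :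
    closeUp m t p (m + t - 1) ∈ N x := by
  have h2 := mem_outWalks.1 (F.ret_subset _ (F.mem_pairs.1 hp).2)
  have h3 := h2.2.2 0 (by omega)
  rw [h2.2.1] at h3
  rw [F.closeUp_apply_ge hp (by omega), show m + t - (m + t - 1) = 0 + 1 by omega]
  exact h3

theorem Frame.closeUp_injOn : Set.InjOn (closeUp m t) (F.pairs m : Set ((ℕ → V) × (ℕ → V))) := by
  intro p hp p' hp' h
  have h1 := F.mem_pairs.1 hp
  have h1' := F.mem_pairs.1 hp'
  refine Prod.ext (funext fun i => ?_) (funext fun i => ?_)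
  · have e1 := (mem_extensions.1 h1.1).1
    have e1' := (mem_extensions.1 h1'.1).1
    rw [← trunc_eq_self e1, ← trunc_eq_self e1']
    simp only [trunc]
    have := congrFun h (min i m)
    rwa [closeUp_apply_le _ (by omega), closeUp_apply_le _ (by omega)] at this
  · have e1 := (mem_outWalks.1 (F.ret_subset _ h1.2)).1
    have e1' := (mem_outWalks.1 (F.ret_subset _ h1'.2)).1
    rw [← trunc_eq_self e1, ← trunc_eq_self e1']
    simp only [trunc]
    have := congrFun h (m + t - min i t)
    rw [F.closeUp_apply_ge hp (by omega), F.closeUp_apply_ge hp' (by omega)] at this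
    rwa [show m + t - (m + t - min i t) = min i t by omega] at this

end Join

end FrameCycles

section BadPairs

open scoped Classical

variable {V : Type*}

theorem exists_transversal {J : Finset ℕ} {t p : ℕ} (hJ : J ⊆ range t) (hp : p < t) (hpJ : p ∉ J) :
    ∃ K ⊆ Ioo 0 t, K.card = J.card ∧ ∀ κ ∈ K, ∃ j ∈ J, κ = j ∨ κ = j + 1 := by
  refine ⟨J.image fun j => if j < p then j + 1 else j, ?_, ?_, ?_⟩
  · intro κ hκ
    obtain ⟨j, hj, rfl⟩ := mem_image.1 hκ
    have h1 := mem_range.1 (hJ hj)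
    have h2 : j ≠ p := fun h => hpJ (h ▸ hj)
    rw [mem_Ioo]
    split_ifs <;> omega
  · refine card_image_of_injOn fun j hj j' hj' h => ?_
    have h2 : j ≠ p := fun h => hpJ (h ▸ hj)
    have h2 : j' ≠ p := fun h => hpJ (h ▸ hj')
    split_ifs at h <;> omega
  · intro κ hκ
    obtain ⟨j, hj, rfl⟩ := mem_image.1 hκ
    refine ⟨j, hj, ?_⟩
    split_ifs <;> simp

theorem card_biUnion_id_le {U : Finset (Finset V)} (h : ∀ e ∈ U, e.card ≤ 2) :
    (U.biUnion id).card ≤ 2 * U.card := by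
  rw [mul_comm]; exact card_biUnion_le_card_mul _ _ _ h

theorem card_edge_le (w : ℕ → V) (i : ℕ) : (edge w i).card ≤ 2 := card_le_two

theorem left_mem_edge (w : ℕ → V) (i : ℕ) : w i ∈ edge w i := by simp [edge]

theorem right_mem_edge (w : ℕ → V) (i : ℕ) : w (i + 1) ∈ edge w i := by simp [edge]

variable [Fintype V]

/-- The sets of `j` edges completing `S` to a saturated set. -/
noncomputable def links (Sat : Finset (Finset V) → Prop) (S : Finset (Finset V)) (j : ℕ) :
    Finset (Finset (Finset V)) :=
  univ.filter fun U => (U.card = j ∧ Disjoint S U ∧ Sat (S ∪ U)) ∧ ∀ e ∈ U, e.card ≤ 2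

theorem card_links_le {Sat : Finset (Finset V) → Prop} {ε B : ℝ} (hL : LinkBound Sat ε B)
    {S : Finset (Finset V)} (hS : S.Nonempty) (hSat : ¬ Sat S) {j : ℕ} (hj : 1 ≤ j) :
    ((links Sat S j).card : ℝ) ≤ ε * B ^ j :=
  hL S hS hSat j hj _ fun _ hU => (mem_filter.1 hU).2.1

theorem MinSat.edges_mem_links {Sat : Finset (Finset V) → Prop} {w : ℕ → V} {I J K : Finset ℕ}
    (h : MinSat Sat w I) (hI : J ∪ K = I) (hJK : Disjoint J K) :
    edges w K ∈ links Sat (edges w J) K.card := by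
  have hJ : J ⊆ I := hI ▸ subset_union_left
  have hK : K ⊆ I := hI ▸ subset_union_right
  refine mem_filter.2 ⟨mem_univ _, ⟨h.card_edges hK, h.disjoint_edges hJ hK hJK, ?_⟩, ?_⟩
  · rw [edges, edges, ← image_union, hI]; exact h.1
  · intro e he
    obtain ⟨i, -, rfl⟩ := mem_image.1 he
    exact card_edge_le w i

namespace Frame

variable {N : V → Finset V} {Sat : Finset (Finset V) → Prop}
  {B γ : ℝ} {d t b q : ℕ} {x : V} (F : Frame N Sat B γ d t b q x)

theorem card_ret_filter_le (v : V) {K : Finset ℕ} (hK : K ⊆ Ioo 0 t) (hne : K.Nonempty)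
    (W : Finset V) : (((F.ret v).filter fun w => ∀ κ ∈ K, w κ ∈ W).card : ℝ) ≤
      B ^ (t - 1 - K.card) * (W.card : ℝ) ^ K.card := by
  have hfib : ∀ g ∈ K.pi fun _ => W,
      ((((F.ret v).filter fun w => ∀ κ ∈ K, w κ ∈ W).filter fun w => (fun κ _ => w κ) = g).card : ℝ) ≤
        B ^ (t - 1 - K.card) := by
    intro g _
    refine le_trans (Nat.cast_le.2 (card_le_card ?_))
      (F.ret_spread v K (fun κ => if h : κ ∈ K then g κ h else x) hK hne)
    intro w hw
    obtain ⟨hw1, rfl⟩ := mem_filter.1 hw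
    refine mem_filter.2 ⟨(mem_filter.1 hw1).1, fun κ hκ => ?_⟩
    rw [dif_pos hκ]
  have h1 := card_le_mul_card_of_fibers (s := (F.ret v).filter fun w => ∀ κ ∈ K, w κ ∈ W)
    (t := K.pi fun _ => W) (fun w κ _ => w κ) (fun w hw => by
      rw [Finset.mem_pi]
      exact (mem_filter.1 hw).2) (c := B ^ (t - 1 - K.card)) (by
      intro g hg
      convert hfib g hg)
  rw [card_pi, prod_const] at h1
  exact_mod_cast h1

theorem card_le_of_fst (hN : ∀ v, (N v).card ≤ d) (hb : γ * B ≤ b) (hbd : b ≤ d) (hγB : 0 ≤ γ * B)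
    {m i : ℕ} (hi : i < m) (τ : (ℕ → V) → Finset V) {s : ℝ} (hτ : ∀ w, ((τ w).card : ℝ) ≤ s)
    (A : Finset ((ℕ → V) × (ℕ → V))) (hA : A ⊆ F.pairs m)
    (hAτ : ∀ p ∈ A, p.1 (i + 1) ∈ τ (trunc i p.1)) :
    A.card * (γ * B) ≤ s * ((∏ i ∈ range m, stepBound d t b i) * q) := by
  have h1 : (A.card : ℝ) ≤ q * (A.image Prod.fst).card :=
    card_le_of_snd_mem A _ (fun p hp => mem_image_of_mem _ hp) (fun R => F.ret (R m))
      (fun p hp => (F.mem_pairs.1 (hA hp)).2) fun R _ => by exact_mod_cast F.card_ret_le _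
  have h2 := card_filter_extensions_mul_le {fun _ => x} (σ := F.step) (Nat.zero_le i) hi
    (a := stepBound d t b) (fun i _ _ w => F.card_step_le hN i w) (A.image Prod.fst) (by
      intro R hR
      obtain ⟨p, hp, rfl⟩ := mem_image.1 hR
      exact F.outExt_subset (F.mem_pairs.1 (hA hp)).1) τ hτ (by
      intro R hR
      obtain ⟨p, hp, rfl⟩ := mem_image.1 hR
      exact hAτ p hp) (stepBound_nonneg _ _ _ _)
  rw [card_singleton, Nat.cast_one, one_mul, Nat.Ico_zero_eq_range] at h2
  have h3 : γ * B ≤ stepBound d t b i := hb.trans (le_stepBound hbd i)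
  calc A.card * (γ * B) ≤ q * (A.image Prod.fst).card * (γ * B) := by gcongr
    _ ≤ q * (A.image Prod.fst).card * stepBound d t b i := by gcongr
    _ = q * ((A.image Prod.fst).card * stepBound d t b i) := by ring
    _ ≤ q * (s * ∏ i ∈ range m, stepBound d t b i) := by gcongr
    _ = _ := by ring

theorem card_selfMeet_le (hN : ∀ v, (N v).card ≤ d) (hb : γ * B ≤ b) (hbd : b ≤ d)
    (hγB : 0 ≤ γ * B) {m i j : ℕ} (hi : i < m) (hj : j ≤ i) :
    ((F.pairs m).filter fun p => p.1 (i + 1) = p.1 j).card * (γ * B) ≤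
      (∏ i ∈ range m, stepBound d t b i) * q := by
  have := F.card_le_of_fst hN hb hbd hγB hi (fun w => {w j}) (s := 1) (by simp)
    ((F.pairs m).filter fun p => p.1 (i + 1) = p.1 j) (filter_subset _ _) (by
      intro p hp
      rw [mem_singleton, trunc_apply _ hj]
      exact (mem_filter.1 hp).2)
  rwa [one_mul] at this

theorem card_meet_le (hN : ∀ v, (N v).card ≤ d) (hB : 0 ≤ B) (hq : γ * B ^ (t - 1) ≤ q)
    (hγ : 0 ≤ γ) {m κ : ℕ} (j : ℕ) (hκ : 0 < κ) (hκt : κ < t) :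
    ((F.pairs m).filter fun p => p.2 κ = p.1 j).card * (γ * B) ≤
      (∏ i ∈ range m, stepBound d t b i) * q := by
  set A := (F.pairs m).filter fun p => p.2 κ = p.1 j with hA
  have h1 : (A.card : ℝ) ≤ B ^ (t - 2) * (F.outExt m).card := by
    refine card_le_of_snd_mem A _ (fun p hp => (F.mem_pairs.1 (mem_filter.1 hp).1).1)
      (fun R => (F.ret (R m)).filter fun w => ∀ i ∈ ({κ} : Finset ℕ), w i ∈ ({R j} : Finset V))
      ?_ ?_
    · intro p hp
      obtain ⟨h1, h2⟩ := mem_filter.1 hp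
      refine mem_filter.2 ⟨(F.mem_pairs.1 h1).2, ?_⟩
      simpa using h2
    · intro R _
      refine (F.card_ret_filter_le (R m) ?_ (singleton_nonempty κ) {R j}).trans ?_
      · simp [hκ, hκt]
      · rw [card_singleton, card_singleton, Nat.sub_sub]; simp
  have h2 := F.card_outExt_le hN m
  have h3 : B ^ (t - 1) = B ^ (t - 2) * B := by rw [← pow_succ]; congr 1; omega
  calc A.card * (γ * B) ≤ B ^ (t - 2) * (F.outExt m).card * (γ * B) := by gcongr
    _ = γ * B ^ (t - 1) * (F.outExt m).card := by rw [h3]; ring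
    _ ≤ q * ∏ i ∈ range m, stepBound d t b i := by gcongr
    _ = _ := mul_comm _ _

variable {ε : ℝ}

/-- Few pairs have a minimal saturated set contained in the first walk. -/
theorem card_minSat_fst_le (hN : ∀ v, (N v).card ≤ d) (hb : γ * B ≤ b) (hbd : b ≤ d)
    (hγ : 0 ≤ γ) (hB : 0 < B) (hL : LinkBound Sat ε B) (hε : 0 ≤ ε) {m : ℕ}
    {I : Finset ℕ} (hI : I ⊆ range m) (hI2 : 2 ≤ I.card) :
    ((F.pairs m).filter fun p => MinSat Sat (closeUp m t p) I).card * γ ≤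
      ε * ((∏ i ∈ range m, stepBound d t b i) * q) := by
  set A := (F.pairs m).filter fun p => MinSat Sat (closeUp m t p) I with hA
  have hmin : ∀ p ∈ A, MinSat Sat p.1 I := by
    intro p hp
    have h1 := (mem_filter.1 hp).2
    have h2 : ∀ J ⊆ I, edges (closeUp m t p) J = edges p.1 J := fun J hJ =>
      edges_congr fun i hi => by
        have := mem_range.1 (hI (hJ hi))
        rw [closeUp_apply_le p this.le, closeUp_apply_le p this]
        exact ⟨rfl, rfl⟩
    refine ⟨h2 I Subset.rfl ▸ h1.1, fun J hJ => ?_⟩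
    rw [← h2 J hJ.1]; exact h1.2 J hJ
  have hne : I.Nonempty := card_pos.1 (by omega)
  set i := I.max' hne with hi
  have hiI : i ∈ I := I.max'_mem hne
  have hmax : ∀ j ∈ I, j ≤ i := fun j hj => I.le_max' j hj
  have h1 := F.card_le_of_fst hN hb hbd (by positivity) (mem_range.1 (hI hiI)) (linkStep Sat I i)
    (card_linkStep_le hL hε hB.le I i) A (filter_subset _ _) fun p hp =>
      (hmin p hp).mem_linkStep hiI
        (card_pos.1 (by rw [card_erase_of_mem hiI]; omega)) hmax
  refine le_of_mul_le_mul_right (le_trans (le_of_eq ?_) (h1.trans (le_of_eq ?_))) hB <;> ring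

/-- Few pairs have a minimal saturated set that meets both walks and omits an edge of the return
walk. -/
theorem card_minSat_both_le (hN : ∀ v, (N v).card ≤ d) (hq : γ * B ^ (t - 1) ≤ q)
    (hγ : 0 ≤ γ) (hB : 0 < B) (hL : LinkBound Sat ε B) (hε : 0 ≤ ε) {m : ℕ}
    {I I₁ I₂ : Finset ℕ} (hI : I₁ ∪ I₂ = I) (hI₁ : I₁ ⊆ range m) (hI₁' : I₁.Nonempty)
    (hI₂ : I₂ ⊂ Ico m (m + t)) (hI₂' : I₂.Nonempty) :
    ((F.pairs m).filter fun p => MinSat Sat (closeUp m t p) I).card * γ ≤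
      ε * (2 * (m + t)) ^ (m + t) * ((∏ i ∈ range m, stepBound d t b i) * q) := by
  set A := (F.pairs m).filter fun p => MinSat Sat (closeUp m t p) I with hA
  have hdisj : Disjoint I₁ I₂ := by
    rw [disjoint_left]
    intro i h1 h2
    have := mem_range.1 (hI₁ h1)
    have := mem_Ico.1 (hI₂.1 h2)
    omega
  have hss : I₁ ⊂ I := by
    obtain ⟨i, hi⟩ := hI₂'
    refine (ssubset_iff_of_subset (hI ▸ subset_union_left)).2 ⟨i, hI ▸ mem_union_right _ hi, ?_⟩
    exact fun h => disjoint_left.1 hdisj h hi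
  obtain ⟨p₀, hp₀, hp₀'⟩ := exists_of_ssubset hI₂
  rw [mem_Ico] at hp₀
  have hI₂t : I₂.card < t := by
    have := card_lt_card hI₂
    rw [Nat.card_Ico] at this; omega
  have hcJ : (I₂.image fun i => m + t - 1 - i).card = I₂.card := by
    refine card_image_of_injOn fun i hi j hj h => ?_
    have h1 := mem_Ico.1 (hI₂.1 hi)
    have h2 := mem_Ico.1 (hI₂.1 hj)
    omega
  obtain ⟨K, hK, hKc, hKJ⟩ := exists_transversal (t := t) (p := m + t - 1 - p₀)
    (J := I₂.image fun i => m + t - 1 - i) (by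
      intro j hj
      obtain ⟨i, hi, rfl⟩ := mem_image.1 hj
      have h1 := mem_Ico.1 (hI₂.1 hi)
      rw [mem_range]; omega) (by omega) (by
      intro h
      obtain ⟨i, hi, h2⟩ := mem_image.1 h
      have h1 := mem_Ico.1 (hI₂.1 hi)
      have : i = p₀ := by omega
      exact hp₀' (this ▸ hi))
  rw [hcJ] at hKc
  have hedge : ∀ p ∈ A, edges (closeUp m t p) I₁ = edges p.1 I₁ := fun p hp =>
    edges_congr fun i hi => by
      have := mem_range.1 (hI₁ hi)
      rw [closeUp_apply_le p this.le, closeUp_apply_le p this]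
      exact ⟨rfl, rfl⟩
  have hj1 : 1 ≤ I₂.card := card_pos.2 hI₂'
  have h1 : (A.card : ℝ) ≤
      (ε * B ^ I₂.card * (B ^ (t - 1 - I₂.card) * (2 * (m + t)) ^ (m + t))) *
        (A.image Prod.fst).card := by
    refine card_le_of_snd_mem A _ (fun p hp => mem_image_of_mem _ hp)
      (fun R => (links Sat (edges R I₁) I₂.card).biUnion fun U =>
        (F.ret (R m)).filter fun w => ∀ κ ∈ K, w κ ∈ U.biUnion id) ?_ ?_
    · intro p hp
      obtain ⟨hp1, hp2⟩ := mem_filter.1 hp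
      have h3 := hp2.edges_mem_links hI hdisj
      rw [hedge p hp] at h3
      refine mem_biUnion.2 ⟨_, h3, mem_filter.2 ⟨(F.mem_pairs.1 hp1).2, fun κ hκ => ?_⟩⟩
      obtain ⟨j, hj, hκj⟩ := hKJ κ hκ
      obtain ⟨i, hi, rfl⟩ := mem_image.1 hj
      have h5 := mem_Ico.1 (hI₂.1 hi)
      refine mem_biUnion.2 ⟨edge (closeUp m t p) i, mem_image_of_mem _ hi, ?_⟩
      rw [F.edge_closeUp_ge hp1 h5.1 h5.2, id]
      rcases hκj with rfl | rfl
      · exact left_mem_edge _ _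
      · exact right_mem_edge _ _
    · intro R hR
      obtain ⟨p, hp, rfl⟩ := mem_image.1 hR
      have hS : ¬ Sat (edges p.1 I₁) := by
        rw [← hedge p hp]
        exact (mem_filter.1 hp).2.2 _ hss
      refine (Nat.cast_le.2 card_biUnion_le).trans ?_
      push_cast
      calc _ ≤ ∑ _U ∈ links Sat (edges p.1 I₁) I₂.card,
            B ^ (t - 1 - I₂.card) * (2 * (m + t) : ℝ) ^ (m + t) := by
            refine sum_le_sum fun U hU => ?_
            obtain ⟨-, hU1, hU2⟩ := mem_filter.1 hU
            refine (F.card_ret_filter_le (p.1 m) hK (card_pos.1 (by omega)) (U.biUnion id)).trans ?_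
            rw [hKc]
            refine mul_le_mul_of_nonneg_left ?_ (by positivity)
            have h6 := card_biUnion_id_le hU2
            rw [hU1.1] at h6
            have h7 : ((U.biUnion id).card : ℝ) ≤ 2 * (m + t) := by
              exact_mod_cast h6.trans (by omega)
            have h8 : (1 : ℝ) ≤ 2 * (m + t) := by exact_mod_cast (by omega : 1 ≤ 2 * (m + t))
            calc ((U.biUnion id).card : ℝ) ^ I₂.card ≤ (2 * (m + t) : ℝ) ^ I₂.card := by gcongr
              _ ≤ _ := pow_le_pow_right₀ h8 (by omega)
        _ = (links Sat (edges p.1 I₁) I₂.card).card *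
            (B ^ (t - 1 - I₂.card) * (2 * (m + t) : ℝ) ^ (m + t)) := by
            rw [sum_const, nsmul_eq_mul]
        _ ≤ _ := by
            refine mul_le_mul_of_nonneg_right ?_ (by positivity)
            exact card_links_le hL (hI₁'.image _) hS hj1
  have h2 : ((A.image Prod.fst).card : ℝ) ≤ ∏ i ∈ range m, stepBound d t b i := by
    refine (Nat.cast_le.2 (card_le_card ?_)).trans (F.card_outExt_le hN m)
    intro R hR
    obtain ⟨p, hp, rfl⟩ := mem_image.1 hR
    exact (F.mem_pairs.1 (mem_filter.1 hp).1).1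
  have h3 : B ^ I₂.card * B ^ (t - 1 - I₂.card) = B ^ (t - 1) := by
    rw [← pow_add]; congr 1; omega
  have hprod : 0 ≤ ∏ i ∈ range m, stepBound d t b i := prod_nonneg fun i _ => stepBound_nonneg _ _ _ _
  calc A.card * γ ≤ (ε * B ^ I₂.card * (B ^ (t - 1 - I₂.card) * (2 * (m + t)) ^ (m + t))) *
        (A.image Prod.fst).card * γ := by gcongr
    _ ≤ (ε * B ^ I₂.card * (B ^ (t - 1 - I₂.card) * (2 * (m + t)) ^ (m + t))) *
        (∏ i ∈ range m, stepBound d t b i) * γ := by gcongr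
    _ = ε * (2 * (m + t)) ^ (m + t) * ((∏ i ∈ range m, stepBound d t b i) *
        (γ * (B ^ I₂.card * B ^ (t - 1 - I₂.card)))) := by ring
    _ ≤ _ := by rw [h3]; gcongr

end Frame

end BadPairs

section LongSuffix

open scoped Classical

variable {V : Type*} [Fintype V] {N : V → Finset V} {Sat : Finset (Finset V) → Prop}
  {B γ ε : ℝ} {d t b q : ℕ} {x : V}

/-- The sets of `j` edges completing `S` to a saturated set or, if `S` is empty, the saturated
sets of `j` edges which contain an edge at `x`. -/
noncomputable def rootedLinks (N : V → Finset V) (Sat : Finset (Finset V) → Prop) (x : V)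
    (S : Finset (Finset V)) (j : ℕ) : Finset (Finset (Finset V)) :=
  if S.Nonempty then links Sat S j
  else (N x).biUnion fun y => (links Sat {{x, y}} (j - 1)).image (insert {x, y})

theorem card_rootedLinks_le (hN : ∀ v, (N v).card ≤ d) (hL : LinkBound Sat ε B) (hε : 0 ≤ ε)
    (hB : 0 ≤ B) (hBd : B ≤ d) (h1 : ∀ u v, v ∈ N u → ¬ Sat {{u, v}})
    {S : Finset (Finset V)} (hS : ¬ Sat S) {j : ℕ} (hj : 2 ≤ j) :
    ((rootedLinks N Sat x S j).card : ℝ) ≤ ε * d * B ^ (j - 1) := by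
  rw [rootedLinks]
  split_ifs with h
  · refine (card_links_le hL h hS (by omega)).trans ?_
    rw [show j = j - 1 + 1 by omega, Nat.add_sub_cancel, pow_succ]
    calc ε * (B ^ (j - 1) * B) ≤ ε * (B ^ (j - 1) * d) := by gcongr
      _ = _ := by ring
  · refine (Nat.cast_le.2 card_biUnion_le).trans ?_
    push_cast
    calc _ ≤ ∑ y ∈ N x, ε * B ^ (j - 1) := by
          refine sum_le_sum fun y hy => ?_
          exact (Nat.cast_le.2 card_image_le).trans
            (card_links_le hL (singleton_nonempty _) (h1 x y hy) (by omega))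
      _ = (N x).card * (ε * B ^ (j - 1)) := by rw [sum_const, nsmul_eq_mul]
      _ ≤ d * (ε * B ^ (j - 1)) := by
          have : ((N x).card : ℝ) ≤ d := by exact_mod_cast hN x
          gcongr
      _ = _ := by ring

theorem mem_rootedLinks_card {S U : Finset (Finset V)} {j : ℕ} (hj : 1 ≤ j)
    (hU : U ∈ rootedLinks N Sat x S j) : U.card ≤ j ∧ ∀ e ∈ U, e.card ≤ 2 := by
  rw [rootedLinks] at hU
  split_ifs at hU with h
  · obtain ⟨-, h1, h2⟩ := mem_filter.1 hU
    exact ⟨h1.1.le, h2⟩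
  · obtain ⟨y, -, h1⟩ := mem_biUnion.1 hU
    obtain ⟨U', h2, rfl⟩ := mem_image.1 h1
    obtain ⟨-, h3, h4⟩ := mem_filter.1 h2
    refine ⟨(card_insert_le _ _).trans (by rw [h3.1]; omega), fun e he => ?_⟩
    rcases mem_insert.1 he with rfl | he
    · exact card_le_two
    · exact h4 e he

namespace Frame

variable (F : Frame N Sat B γ d t b q x)

/-- A pair is determined by a prefix and the list of remaining vertices, so few pairs have their
remaining edges in a small collection. -/
theorem card_le_of_suffix (hN : ∀ v, (N v).card ≤ d) {m i : ℕ} (hi : i < m)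
    (A : Finset ((ℕ → V) × (ℕ → V))) (hA : A ⊆ F.pairs m)
    (𝒰 : (ℕ → V) → Finset (Finset (Finset V))) {c : ℝ} (hc : 0 ≤ c)
    (hA𝒰 : ∀ p ∈ A, edges (closeUp m t p) (Ico (i + 1) (m + t)) ∈ 𝒰 (trunc i p.1))
    (h𝒰c : ∀ p ∈ A, ((𝒰 (trunc i p.1)).card : ℝ) ≤ c)
    (h𝒰 : ∀ R, ∀ U ∈ 𝒰 R, U.card ≤ m + t ∧ ∀ e ∈ U, e.card ≤ 2) :
    (A.card : ℝ) ≤ (2 * (m + t)) ^ (m + t) * c * ∏ i ∈ range i, stepBound d t b i := by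
  have h1 : (A.card : ℝ) ≤ (2 * (m + t)) ^ (m + t) * c * (A.image fun p => trunc i p.1).card := by
    refine card_le_mul_card_of_fibers (fun p => trunc i p.1)
      (fun p hp => mem_image_of_mem (fun p : (ℕ → V) × (ℕ → V) => trunc i p.1) hp) fun R hR => ?_
    obtain ⟨p₀, hp₀, rfl⟩ := mem_image.1 hR
    refine le_trans ?_ (mul_le_mul_of_nonneg_left (h𝒰c p₀ hp₀) (by positivity))
    refine card_le_mul_card_of_fibers (fun p => edges (closeUp m t p) (Ico (i + 1) (m + t)))
      (fun p hp => ?_) fun U hU => ?_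
    · obtain ⟨h1, h2⟩ := mem_filter.1 hp
      rw [← h2]; exact hA𝒰 p h1
    · obtain ⟨hU1, hU2⟩ := h𝒰 _ U hU
      have h2 := card_biUnion_id_le hU2
      have h3 : ((U.biUnion id).card : ℝ) ≤ 2 * (m + t) := by exact_mod_cast h2.trans (by omega)
      have h4 : (1 : ℝ) ≤ 2 * (m + t) := by exact_mod_cast (by omega : 1 ≤ 2 * (m + t))
      have h5 : ((U.biUnion id).card : ℝ) ^ (m + t - (i + 1)) ≤ (2 * (m + t)) ^ (m + t) :=
        (pow_le_pow_left₀ (Nat.cast_nonneg _) h3 _).trans (pow_le_pow_right₀ h4 (by omega))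
      refine le_trans ?_ h5
      have h6 : ((Ico (i + 1) (m + t)).pi fun _ => U.biUnion id).card =
          (U.biUnion id).card ^ (m + t - (i + 1)) := by
        rw [card_pi, prod_const, Nat.card_Ico]
      rw [← Nat.cast_pow, ← h6]
      refine Nat.cast_le.2 (card_le_card_of_injOn (fun p k _ => closeUp m t p k) ?_ ?_)
      · intro p hp
        have h7 := (mem_filter.1 hp).2
        refine Finset.mem_pi.2 fun k hk => mem_biUnion.2 ⟨edge (closeUp m t p) k, ?_, left_mem_edge _ _⟩
        rw [← h7]; exact mem_image_of_mem _ hk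
      · intro p hp p' hp' h
        have h7 := mem_filter.1 (mem_filter.1 hp).1
        have h7' := mem_filter.1 (mem_filter.1 hp').1
        refine F.closeUp_injOn (hA h7.1) (hA h7'.1) (funext fun k => ?_)
        rcases Nat.lt_or_ge i k with hk | hk
        · rcases Nat.lt_or_ge k (m + t) with hk' | hk'
          · exact congrFun (congrFun h k) (mem_Ico.2 ⟨hk, hk'⟩)
          · rw [F.closeUp_apply_ge (hA h7.1) (by omega), F.closeUp_apply_ge (hA h7'.1) (by omega),
              Nat.sub_eq_zero_of_le hk',
              (mem_outWalks.1 (F.ret_subset _ (F.mem_pairs.1 (hA h7.1)).2)).2.1,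
              (mem_outWalks.1 (F.ret_subset _ (F.mem_pairs.1 (hA h7'.1)).2)).2.1]
        · rw [closeUp_apply_le _ (by omega), closeUp_apply_le _ (by omega),
            ← trunc_apply p.1 hk, ← trunc_apply p'.1 hk, h7.2, h7'.2]
  refine h1.trans (mul_le_mul_of_nonneg_left ?_ (by positivity))
  have h2 := card_extensions_le {fun _ => x} (σ := F.step) (Nat.zero_le i)
    (a := stepBound d t b) fun i _ _ w => F.card_step_le hN i w
  rw [card_singleton, Nat.cast_one, one_mul, Nat.Ico_zero_eq_range] at h2
  refine (Nat.cast_le.2 (card_le_card ?_)).trans h2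
  intro R hR
  obtain ⟨p, hp, rfl⟩ := mem_image.1 hR
  exact trunc_mem_extensions (Nat.zero_le _) hi.le (F.outExt_subset (F.mem_pairs.1 (hA hp)).1)

/-- Few pairs have a minimal saturated set which contains all edges after a missing one. -/
theorem card_minSat_suffix_le (hN : ∀ v, (N v).card ≤ d) (hb : γ * B ≤ b) (hbd : b ≤ d)
    (hq : γ * B ^ (t - 1) ≤ q) (hγ : 0 ≤ γ) (hγ1 : γ ≤ 1) (hB : 0 < B) (hBd : B ≤ d)
    (hL : LinkBound Sat ε B) (hε : 0 ≤ ε) (h1 : ∀ u v, v ∈ N u → ¬ Sat {{u, v}}) (ht : 2 ≤ t)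
    {m r : ℕ} (hm : m = t + 2 * r) {i : ℕ} (hi : i < m) {I I₀ : Finset ℕ} (hI₀ : I₀ ⊆ range i)
    (hI : I₀ ∪ Ico (i + 1) (m + t) = I) :
    ((F.pairs m).filter fun p => MinSat Sat (closeUp m t p) I).card * γ ^ (m + t) ≤
      ε * (2 * (m + t)) ^ (m + t) * ((∏ i ∈ range m, stepBound d t b i) * q) := by
  set A := (F.pairs m).filter fun p => MinSat Sat (closeUp m t p) I with hA
  have hdisj : Disjoint I₀ (Ico (i + 1) (m + t)) := by
    rw [disjoint_left]
    intro k h1 h2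
    have := mem_range.1 (hI₀ h1)
    have := mem_Ico.1 h2
    omega
  have hss : I₀ ⊂ I := by
    refine (ssubset_iff_of_subset (hI ▸ subset_union_left)).2 ⟨i + 1, ?_, ?_⟩
    · exact hI ▸ mem_union_right _ (mem_Ico.2 (by omega))
    · intro h
      have := mem_range.1 (hI₀ h)
      omega
  have hedge : ∀ p : (ℕ → V) × (ℕ → V), edges (trunc i p.1) I₀ = edges (closeUp m t p) I₀ := by
    intro p
    rw [edges_trunc _ fun k hk => mem_range.1 (hI₀ hk)]
    refine edges_congr fun k hk => ?_
    have := mem_range.1 (hI₀ hk)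
    rw [closeUp_apply_le p (by omega), closeUp_apply_le p (by omega)]
    exact ⟨rfl, rfl⟩
  have hAc := F.card_le_of_suffix hN hi A (filter_subset _ _)
    (fun R => rootedLinks N Sat x (edges R I₀) (m + t - (i + 1)))
    (c := ε * d * B ^ (m + t - (i + 1) - 1)) (by positivity) (by
      intro p hp
      obtain ⟨hp1, hp2⟩ := mem_filter.1 hp
      rw [hedge p, rootedLinks]
      split_ifs with h
      · have := hp2.edges_mem_links hI hdisj
        rwa [Nat.card_Ico] at this
      · have h2 : I₀ = ∅ := by
          rw [not_nonempty_iff_eq_empty, edges, image_eq_empty] at h; exact h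
        have h3 : insert (m + t - 1) (Ico (i + 1) (m + t - 1)) = Ico (i + 1) (m + t) := by
          ext k; simp only [mem_insert, mem_Ico]; omega
        rw [h2, empty_union, ← h3, insert_eq] at hI
        have h4 := hp2.edges_mem_links hI (by simp)
        have h5 : edge (closeUp m t p) (m + t - 1) = {x, closeUp m t p (m + t - 1)} := by
          rw [edge, Nat.sub_add_cancel (by omega), F.closeUp_last hp1, pair_comm]
        refine mem_biUnion.2 ⟨closeUp m t p (m + t - 1),
          F.closeUp_penultimate_mem (by omega) hp1,
          mem_image.2 ⟨edges (closeUp m t p) (Ico (i + 1) (m + t - 1)), ?_, ?_⟩⟩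
        · rw [edges, image_singleton, h5, Nat.card_Ico] at h4
          rwa [show m + t - (i + 1) - 1 = m + t - 1 - (i + 1) by omega]
        · rw [← h5, edges, edges, ← h3, image_insert])
    (by
      intro p hp
      refine card_rootedLinks_le hN hL hε hB.le hBd h1 ?_ (by omega)
      rw [hedge p]
      exact (mem_filter.1 hp).2.2 _ hss)
    (by
      intro R U hU
      obtain ⟨h2, h3⟩ := mem_rootedLinks_card (by omega) hU
      exact ⟨by omega, h3⟩)
  have hprod : (d : ℝ) * (γ * B) ^ (m - 1 - i) ≤ ∏ k ∈ Ico i m, stepBound d t b k := by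
    have h2 := prod_Ico_succ_top (show i ≤ m - 1 by omega) (stepBound d t b)
    rw [Nat.sub_add_cancel (by omega)] at h2
    rw [h2, stepBound_last (by omega) hm, mul_comm]
    refine mul_le_mul_of_nonneg_right ?_ (Nat.cast_nonneg _)
    rw [← Nat.card_Ico, ← prod_const]
    exact prod_le_prod (fun _ _ => by positivity) fun k _ => hb.trans (le_stepBound hbd k)
  have hpow : B ^ (m + t - (i + 1) - 1) = B ^ (m - 1 - i) * B ^ (t - 1) := by
    rw [← pow_add]; congr 1; omega
  have hγp : γ ^ (m + t) ≤ γ ^ (m - 1 - i) * γ := by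
    rw [← pow_succ]; exact pow_le_pow_of_le_one hγ hγ1 (by omega)
  have hP : 0 ≤ ∏ k ∈ range i, stepBound d t b k := prod_nonneg fun _ _ => stepBound_nonneg _ _ _ _
  have hP' : 0 ≤ ∏ k ∈ Ico i m, stepBound d t b k := prod_nonneg fun _ _ => stepBound_nonneg _ _ _ _
  rw [← prod_range_mul_prod_Ico _ hi.le]
  set Q := ∏ k ∈ range i, stepBound d t b k
  set κ : ℝ := (2 * (m + t)) ^ (m + t) with hκ
  have hκ0 : 0 ≤ κ := by positivity
  calc A.card * γ ^ (m + t) ≤ κ * (ε * d * B ^ (m + t - (i + 1) - 1)) * Q *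
        (γ ^ (m - 1 - i) * γ) := by gcongr
    _ = ε * κ * (Q * (d * (γ * B) ^ (m - 1 - i)) * (γ * B ^ (t - 1))) := by
        rw [hpow, mul_pow]; ring
    _ ≤ _ := by gcongr

end Frame

end LongSuffix

section GoodPairs

open scoped Classical

variable {V : Type*} [Fintype V] {N : V → Finset V} {Sat : Finset (Finset V) → Prop}
  {B γ ε : ℝ} {d t b q : ℕ} {x : V}

/-- A closed sequence of length `L` which traces a cycle with no saturated set of edges. -/
def GoodCycle (Sat : Finset (Finset V) → Prop) (L : ℕ) (w : ℕ → V) : Prop :=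
  Set.InjOn w (Set.Iio L) ∧ ∀ S ⊆ edges w (range L), ¬ Sat S

namespace Frame

variable (F : Frame N Sat B γ d t b q x)

theorem card_minSat_le (hN : ∀ v, (N v).card ≤ d) (hb : γ * B ≤ b) (hbd : b ≤ d)
    (hq : γ * B ^ (t - 1) ≤ q) (hγ : 0 ≤ γ) (hγ1 : γ ≤ 1) (hB : 0 < B) (hBd : B ≤ d)
    (hL : LinkBound Sat ε B) (hε : 0 ≤ ε) (h0 : ¬ Sat ∅) (h1 : ∀ u v, v ∈ N u → ¬ Sat {{u, v}})
    (ht : 2 ≤ t) {m r : ℕ} (hm : m = t + 2 * r) (hs : ∀ S, Sat S → S.card < m + t)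
    {I : Finset ℕ} (hI : I ⊆ range (m + t)) :
    ((F.pairs m).filter fun p => MinSat Sat (closeUp m t p) I).card * γ ^ (m + t) ≤
      ε * (2 * (m + t)) ^ (m + t) * ((∏ i ∈ range m, stepBound d t b i) * q) := by
  have hP : 0 ≤ ∏ k ∈ range m, stepBound d t b k := prod_nonneg fun _ _ => stepBound_nonneg _ _ _ _
  have hγp : γ ^ (m + t) ≤ γ := pow_le_of_le_one hγ hγ1 (by omega)
  have htriv : (∀ p ∈ F.pairs m, ¬ MinSat Sat (closeUp m t p) I) →
      ((F.pairs m).filter fun p => MinSat Sat (closeUp m t p) I).card * γ ^ (m + t) ≤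
      ε * (2 * (m + t)) ^ (m + t) * ((∏ i ∈ range m, stepBound d t b i) * q) := by
    intro h
    rw [filter_false_of_mem h, card_empty, Nat.cast_zero, zero_mul]
    positivity
  by_cases hfull : I = range (m + t)
  · refine htriv fun p _ hmin => ?_
    have h2 := hmin.card_edges Subset.rfl
    have h3 := hs _ hmin.1
    rw [h2, hfull, card_range] at h3
    exact lt_irrefl _ h3
  have hsplit : I.filter (· < m) ∪ I.filter (¬ · < m) = I := filter_union_filter_not_eq _ _
  by_cases hlong : Ico m (m + t) ⊆ I
  · have hne : ((range m).filter (· ∉ I)).Nonempty := by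
      by_contra h
      rw [not_nonempty_iff_eq_empty, filter_eq_empty_iff] at h
      refine hfull (Subset.antisymm hI fun k hk => ?_)
      rcases Nat.lt_or_ge k m with h2 | h2
      · exact not_not.1 (h (mem_range.2 h2))
      · exact hlong (mem_Ico.2 ⟨h2, mem_range.1 hk⟩)
    set i := ((range m).filter (· ∉ I)).max' hne with hi
    obtain ⟨hi1, hi2⟩ := mem_filter.1 (max'_mem _ hne)
    have hmax : ∀ k, i < k → k < m + t → k ∈ I := by
      intro k hk hk'
      rcases Nat.lt_or_ge k m with h2 | h2
      · by_contra h3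
        exact absurd (le_max' _ k (mem_filter.2 ⟨mem_range.2 h2, h3⟩)) (not_le.2 hk)
      · exact hlong (mem_Ico.2 ⟨h2, hk'⟩)
    refine F.card_minSat_suffix_le hN hb hbd hq hγ hγ1 hB hBd hL hε h1 ht hm (mem_range.1 hi1)
      (I₀ := I.filter (· < i)) ?_ ?_
    · intro k hk
      exact mem_range.2 (mem_filter.1 hk).2
    · ext k
      rw [mem_union, mem_filter, mem_Ico]
      constructor
      · rintro (h | h)
        · exact h.1
        · exact hmax k h.1 h.2
      · intro h
        have h2 := mem_range.1 (hI h)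
        have h3 : k ≠ i := by rintro rfl; exact hi2 h
        rcases lt_or_gt_of_ne h3 with h3 | h3
        · exact Or.inl ⟨h, h3⟩
        · exact Or.inr ⟨h3, h2⟩
  · have hI₁ : I.filter (· < m) ⊆ range m := fun k hk => mem_range.2 (mem_filter.1 hk).2
    have hI₂ : I.filter (¬ · < m) ⊂ Ico m (m + t) := by
      have hsub : I.filter (¬ · < m) ⊆ Ico m (m + t) := fun k hk => by
        obtain ⟨h2, h3⟩ := mem_filter.1 hk
        exact mem_Ico.2 ⟨not_lt.1 h3, mem_range.1 (hI h2)⟩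
      refine hsub.ssubset_of_ne fun h => hlong ?_
      rw [← h]; exact filter_subset _ _
    set I₁ := I.filter (· < m)
    set I₂ := I.filter (¬ · < m)
    have hκ : (1 : ℝ) ≤ (2 * (m + t)) ^ (m + t) := by
      refine one_le_pow₀ ?_
      exact_mod_cast (by omega : 1 ≤ 2 * (m + t))
    rcases I₂.eq_empty_or_nonempty with h2 | h2
    · rw [h2, union_empty] at hsplit
      rw [hsplit] at hI₁
      rcases Nat.lt_or_ge 1 I.card with h3 | h3
      · have h4 := F.card_minSat_fst_le hN hb hbd hγ hB hL hε hI₁ h3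
        calc _ ≤ _ * γ := by gcongr
          _ ≤ _ := h4
          _ = ε * 1 * ((∏ i ∈ range m, stepBound d t b i) * q) := by ring
          _ ≤ _ := by gcongr
      · refine htriv fun p hp hmin => ?_
        rcases Nat.le_one_iff_eq_zero_or_eq_one.1 h3 with h4 | h4
        · rw [card_eq_zero] at h4
          have := hmin.1
          rw [h4, edges, image_empty] at this
          exact h0 this
        · obtain ⟨i, rfl⟩ := card_eq_one.1 h4
          have h5 := hmin.1
          rw [edges, image_singleton, edge] at h5
          rcases F.closeUp_adj hp (mem_range.1 (hI (mem_singleton_self i))) with h6 | h6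
          · exact h1 _ _ h6 h5
          · rw [pair_comm] at h5
            exact h1 _ _ h6 h5
    · rcases I₁.eq_empty_or_nonempty with h3 | h3
      · refine htriv fun p hp hmin => ?_
        refine (F.ret_good _ _ (F.mem_pairs.1 hp).2).2 _ ?_ hmin.1
        intro e he
        obtain ⟨i, hi, rfl⟩ := mem_image.1 he
        rw [← hsplit, h3, empty_union] at hi
        have h4 := mem_Ico.1 (hI₂.1 hi)
        rw [F.edge_closeUp_ge hp h4.1 h4.2]
        exact mem_image_of_mem _ (mem_range.2 (by omega))
      · have h4 := F.card_minSat_both_le hN hq hγ hB hL hε hsplit hI₁ h3 hI₂ h2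
        calc _ ≤ _ * γ := by gcongr
          _ ≤ _ := h4

theorem goodCycle_of_forall {m : ℕ} {p : (ℕ → V) × (ℕ → V)} (hp : p ∈ F.pairs m)
    (h1 : ∀ i < m, ∀ j ≤ i, p.1 (i + 1) ≠ p.1 j)
    (h2 : ∀ κ, 0 < κ → κ < t → ∀ j ≤ m, p.2 κ ≠ p.1 j)
    (h3 : ∀ I ⊆ range (m + t), ¬ MinSat Sat (closeUp m t p) I) :
    GoodCycle Sat (m + t) (closeUp m t p) := by
  refine ⟨?_, fun S hS hSat => ?_⟩
  · have key : ∀ a c, a < c → c < m + t → closeUp m t p a ≠ closeUp m t p c := by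
      intro a c hac hc h
      rcases Nat.lt_or_ge m c with hcm | hcm
      · rw [F.closeUp_apply_ge hp hcm.le] at h
        rcases Nat.lt_or_ge m a with ham | ham
        · rw [F.closeUp_apply_ge hp ham.le] at h
          have := (F.ret_good _ _ (F.mem_pairs.1 hp).2).1 (Set.mem_Iic.2 (by omega))
            (Set.mem_Iic.2 (by omega)) h
          omega
        · rw [closeUp_apply_le p ham] at h
          exact h2 _ (by omega) (by omega) a ham h.symm
      · rw [closeUp_apply_le p hcm, closeUp_apply_le p (by omega)] at h
        have := h1 (c - 1) (by omega) a (by omega)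
        rw [Nat.sub_add_cancel (by omega)] at this
        exact this h.symm
    intro a ha c hc h
    by_contra hne
    rcases lt_or_gt_of_ne hne with hlt | hlt
    · exact key a c hlt hc h
    · exact key c a hlt ha h.symm
  · obtain ⟨I, hI, hmin⟩ := exists_minSat hS hSat
    exact h3 I hI hmin

theorem card_goodPairs_ge (hN : ∀ v, (N v).card ≤ d) (hb : γ * B ≤ b) (hbd : b ≤ d)
    (hq : γ * B ^ (t - 1) ≤ q) (hγ : 0 < γ) (hγ1 : γ ≤ 1) (hB : 0 < B) (hBd : B ≤ d)
    (hL : LinkBound Sat ε B) (hε : 0 ≤ ε) (h0 : ¬ Sat ∅) (h1 : ∀ u v, v ∈ N u → ¬ Sat {{u, v}})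
    (ht : 2 ≤ t) {m r : ℕ} (hm : m = t + 2 * r) (hs : ∀ S, Sat S → S.card < m + t)
    (hBK : 8 * (m + t + 1) ^ 2 ≤ γ ^ (m + t) * (γ * B))
    (hεK : 4 * (2 ^ (m + t) * (2 * (m + t)) ^ (m + t)) * ε ≤ γ ^ (m + t) * γ ^ (m + t)) :
    γ ^ (m + t) / 2 * ((∏ i ∈ range m, stepBound d t b i) * q) ≤
      ((F.pairs m).filter fun p => GoodCycle Sat (m + t) (closeUp m t p)).card := by
  set X := (∏ i ∈ range m, stepBound d t b i) * q with hX
  have hP : 0 ≤ ∏ k ∈ range m, stepBound d t b k := prod_nonneg fun _ _ => stepBound_nonneg _ _ _ _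
  have hX0 : 0 ≤ X := by positivity
  set G := (F.pairs m).filter fun p => GoodCycle Sat (m + t) (closeUp m t p) with hG
  set A₁ := ((range m ×ˢ range m).filter fun k => k.2 ≤ k.1).biUnion fun k =>
    (F.pairs m).filter fun p => p.1 (k.1 + 1) = p.1 k.2 with hA₁
  set A₂ := (Ioo 0 t ×ˢ range (m + 1)).biUnion fun k =>
    (F.pairs m).filter fun p => p.2 k.1 = p.1 k.2 with hA₂
  set A₃ := (range (m + t)).powerset.biUnion fun I =>
    (F.pairs m).filter fun p => MinSat Sat (closeUp m t p) I with hA₃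
  have hcover : F.pairs m ⊆ G ∪ (A₁ ∪ (A₂ ∪ A₃)) := by
    intro p hp
    by_contra h
    simp only [mem_union, not_or] at h
    obtain ⟨hg, h2, h3, h4⟩ := h
    refine hg (mem_filter.2 ⟨hp, F.goodCycle_of_forall hp ?_ ?_ ?_⟩)
    · intro i hi j hj he
      exact h2 (mem_biUnion.2 ⟨(i, j), mem_filter.2 ⟨mem_product.2 ⟨mem_range.2 hi,
        mem_range.2 (by dsimp only; omega)⟩, hj⟩, mem_filter.2 ⟨hp, he⟩⟩)
    · intro κ hκ hκt j hj he
      exact h3 (mem_biUnion.2 ⟨(κ, j), mem_product.2 ⟨mem_Ioo.2 ⟨hκ, hκt⟩,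
        mem_range.2 (by dsimp only; omega)⟩, mem_filter.2 ⟨hp, he⟩⟩)
    · intro I hI hmin
      exact h4 (mem_biUnion.2 ⟨I, mem_powerset.2 hI, mem_filter.2 ⟨hp, hmin⟩⟩)
  have hγB : 0 < γ * B := by positivity
  have hc₁ : (A₁.card : ℝ) ≤ (m + t + 1) ^ 2 * (X / (γ * B)) := by
    refine (Nat.cast_le.2 (card_biUnion_le_card_mul _ _ ⌊X / (γ * B)⌋₊ fun k hk => ?_)).trans ?_
    · obtain ⟨h2, h3⟩ := mem_filter.1 hk
      refine Nat.le_floor ?_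
      rw [le_div_iff₀ hγB]
      exact F.card_selfMeet_le hN hb hbd hγB.le (mem_range.1 (mem_product.1 h2).1) h3
    · push_cast
      have h2 : (((range m ×ˢ range m).filter fun k : ℕ × ℕ => k.2 ≤ k.1).card : ℝ) ≤
          (m + t + 1) ^ 2 := by
        refine (Nat.cast_le.2 (card_filter_le _ _)).trans ?_
        rw [card_product, card_range]
        exact_mod_cast (by nlinarith : m * m ≤ (m + t + 1) ^ 2)
      have h3 := Nat.floor_le (show 0 ≤ X / (γ * B) by positivity)
      gcongr
  have hc₂ : (A₂.card : ℝ) ≤ (m + t + 1) ^ 2 * (X / (γ * B)) := by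
    refine (Nat.cast_le.2 (card_biUnion_le_card_mul _ _ ⌊X / (γ * B)⌋₊ fun k hk => ?_)).trans ?_
    · have h2 := mem_Ioo.1 (mem_product.1 hk).1
      refine Nat.le_floor ?_
      rw [le_div_iff₀ hγB]
      exact F.card_meet_le hN hB.le hq hγ.le _ h2.1 h2.2
    · push_cast
      have h2 : ((Ioo 0 t ×ˢ range (m + 1)).card : ℝ) ≤ (m + t + 1) ^ 2 := by
        rw [card_product, card_range, Nat.card_Ioo, sq]
        exact_mod_cast Nat.mul_le_mul (by omega : t - 0 - 1 ≤ m + t + 1) (by omega)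
      have h3 := Nat.floor_le (show 0 ≤ X / (γ * B) by positivity)
      gcongr
  have hγp : 0 < γ ^ (m + t) := by positivity
  have hc₃ : (A₃.card : ℝ) ≤ 2 ^ (m + t) * (ε * (2 * (m + t)) ^ (m + t) * X / γ ^ (m + t)) := by
    refine (Nat.cast_le.2 (card_biUnion_le_card_mul _ _
      ⌊ε * (2 * (m + t)) ^ (m + t) * X / γ ^ (m + t)⌋₊ fun I hI => ?_)).trans ?_
    · refine Nat.le_floor ?_
      rw [le_div_iff₀ hγp]
      exact F.card_minSat_le hN hb hbd hq hγ.le hγ1 hB hBd hL hε h0 h1 ht hm hs (mem_powerset.1 hI)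
    · push_cast
      rw [card_powerset, card_range]
      have h3 := Nat.floor_le
        (show 0 ≤ ε * (2 * (m + t)) ^ (m + t) * X / γ ^ (m + t) by positivity)
      push_cast
      gcongr
  have hb₁ : (m + t + 1 : ℝ) ^ 2 * (X / (γ * B)) ≤ γ ^ (m + t) / 8 * X := by
    rw [mul_div_assoc', div_le_iff₀ hγB]
    nlinarith [mul_le_mul_of_nonneg_right hBK hX0]
  have hb₃ : 2 ^ (m + t) * (ε * (2 * (m + t)) ^ (m + t) * X / γ ^ (m + t)) ≤
      γ ^ (m + t) / 4 * X := by
    rw [mul_div_assoc', div_le_iff₀ hγp]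
    nlinarith [mul_le_mul_of_nonneg_right hεK hX0]
  have hpairs : γ ^ (m + t) * X ≤ (F.pairs m).card := by
    rw [F.card_pairs hm]
    push_cast
    have h2 := F.le_card_outExt hγ.le hγ1 (show t ≤ m by omega)
    calc γ ^ (m + t) * X ≤ γ ^ (m + 1) * X :=
          mul_le_mul_of_nonneg_right (pow_le_pow_of_le_one hγ.le hγ1 (by omega)) hX0
      _ = γ ^ (m + 1) * (∏ i ∈ range m, stepBound d t b i) * q := by rw [hX]; ring
      _ ≤ _ := by gcongr
  have htot : ((F.pairs m).card : ℝ) ≤ G.card + (A₁.card + (A₂.card + A₃.card)) := by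
    have h2 := card_le_card hcover
    have h3 := card_union_le G (A₁ ∪ (A₂ ∪ A₃))
    have h4 := card_union_le A₁ (A₂ ∪ A₃)
    have h5 := card_union_le A₂ A₃
    exact_mod_cast (by omega : (F.pairs m).card ≤ G.card + (A₁.card + (A₂.card + A₃.card)))
  linarith

end Frame

end GoodPairs

section CoreCycles

open scoped Classical

variable {V : Type*} [Fintype V] {N : V → Finset V} {Sat : Finset (Finset V) → Prop}
  {B γ ε θ : ℝ} {d : ℕ}

/-- The frame obtained from a vertex with many walks. -/
theorem exists_frame_of_outWalks {ℓ : ℕ} (hℓ : 2 ≤ ℓ) (hd : 0 < d) (hN : ∀ v, (N v).card ≤ d)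
    (hB : 2 ≤ B) (hBd : B ≤ d) (hBn : B ^ (ℓ - 1) * Fintype.card V ≤ (d : ℝ) ^ ℓ) {x₀ : V}
    (hx₀ : (d : ℝ) ^ ℓ ≤ (outWalks N x₀ ℓ).card) (hL : LinkBound Sat ε B) (hε : 0 ≤ ε)
    (h0 : ¬ Sat ∅) (h1 : ∀ u v, v ∈ N u → ¬ Sat {{u, v}}) (hθ : 0 < θ)
    (hθℓ : 8 * (ℓ + 1) ^ 2 * θ = 1) (hγ : 16 * γ = θ ^ ℓ) (hεγ : 2 ^ ℓ * ε ≤ 2 * γ)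
    (hBγ : (ℓ + 1) ^ 2 ≤ γ * B) :
    ∃ t x, 2 ≤ t ∧ t ≤ ℓ ∧ Nonempty (Frame N Sat B γ d t ⌈γ * B⌉₊ ⌈γ * B ^ (t - 1)⌉₊ x) := by
  have hγ0 : 0 < γ := by
    have : 0 < θ ^ ℓ := by positivity
    linarith
  have hd' : (0 : ℝ) < d := by exact_mod_cast hd
  have hθ1 : θ ≤ 1 := by
    have h2 : (0 : ℝ) ≤ ℓ := Nat.cast_nonneg _
    nlinarith [mul_nonneg h2 hθ.le, mul_nonneg (mul_nonneg h2 h2) hθ.le]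
  obtain ⟨t, x, e, ht, htℓ, he, he1, hheavy, hlight⟩ :=
    exists_concentrated hℓ hd hB hBn hx₀ hθ hθ1
  refine ⟨t, x, ht, htℓ, ?_⟩
  have h2 := card_good_heavyWalks_ge hd hN hL hε (by linarith) hBd h0 h1 (by omega) hheavy hlight
  refine exists_frame hd hN hB hγ0 ht
    ((heavyWalks N B t x).filter fun w => GoodWalk Sat t w ∧ ∀ a b, a < b → b ≤ t → b - a < t →
      ¬ HeavyPair N B (b - a) (w a) (w b)) (filter_subset _ _)
    (fun w hw => (mem_filter.1 hw).2.1) (fun w hw => (mem_filter.1 hw).2.2) (le_trans ?_ h2)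
  refine mul_le_mul_of_nonneg_right ?_ (by positivity)
  have ht' : ((t : ℝ) + 1) ^ 2 ≤ (ℓ + 1) ^ 2 := by
    have : (t : ℝ) ≤ ℓ := by exact_mod_cast htℓ
    gcongr
  have he0 : 0 ≤ e := le_trans (by positivity) he
  have h3 : ((t : ℝ) + 1) ^ 2 * (θ * e) ≤ e / 8 := by
    calc _ ≤ ((ℓ : ℝ) + 1) ^ 2 * (θ * e) := by gcongr
      _ = 8 * (ℓ + 1) ^ 2 * θ * e / 8 := by ring
      _ = e / 8 := by rw [hθℓ, one_mul]
  have h4 : ((t : ℝ) + 1) ^ 2 / d ≤ γ := by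
    rw [div_le_iff₀ hd']
    calc _ ≤ γ * B := ht'.trans hBγ
      _ ≤ γ * d := by gcongr
  have h5 : (2 : ℝ) ^ t * ε ≤ 2 * γ := by
    refine le_trans (mul_le_mul_of_nonneg_right ?_ hε) hεγ
    exact pow_le_pow_right₀ one_le_two htℓ
  linarith

/-- If there are many walks from some vertex then there are many closed walks at a common vertex
tracing a cycle with no saturated set of edges. -/
theorem exists_goodCycles {ℓ : ℕ} (hℓ : 2 ≤ ℓ) : ∃ c ε K : ℝ, 0 < c ∧ 0 < ε ∧
    ∀ {V : Type} [Fintype V] {N : V → Finset V} {Sat : Finset (Finset V) → Prop} {B : ℝ} {d : ℕ}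
      {x₀ : V}, K ≤ B → B ≤ d → B ^ (ℓ - 1) * Fintype.card V ≤ (d : ℝ) ^ ℓ →
      (∀ v, (N v).card ≤ d) → (d : ℝ) ^ ℓ ≤ (outWalks N x₀ ℓ).card → LinkBound Sat ε B →
      (∀ S, Sat S → S.card < 2 * ℓ) → ¬ Sat ∅ → (∀ u v, v ∈ N u → ¬ Sat {{u, v}}) →
      ∃ (x : V) (𝒲 : Finset (ℕ → V)), c * ((d : ℝ) ^ ℓ * B ^ (ℓ - 1)) ≤ 𝒲.card ∧
        ∀ w ∈ 𝒲, w 0 = x ∧ (∀ i, 2 * ℓ ≤ i → w i = x) ∧ w 1 ∈ N x ∧ GoodCycle Sat (2 * ℓ) w ∧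
          ∀ i < 2 * ℓ, w (i + 1) ∈ N (w i) ∨ w i ∈ N (w (i + 1)) := by
  set θ : ℝ := 1 / (8 * (ℓ + 1) ^ 2) with hθ
  set γ : ℝ := θ ^ ℓ / 16 with hγ
  set ε₁ : ℝ := γ ^ (2 * ℓ) * γ ^ (2 * ℓ) / (4 * (2 ^ (2 * ℓ) * (2 * (2 * ℓ)) ^ (2 * ℓ))) with hε₁
  set ε₂ : ℝ := 2 * γ / 2 ^ ℓ with hε₂
  set K₁ : ℝ := 8 * (2 * ℓ + 1) ^ 2 / γ ^ (2 * ℓ + 1) with hK₁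
  set K₂ : ℝ := (ℓ + 1) ^ 2 / γ with hK₂
  have hθ0 : 0 < θ := by positivity
  have hγ0 : 0 < γ := by positivity
  have hℓ0 : (0 : ℝ) < ℓ := by exact_mod_cast (by omega : 0 < ℓ)
  have hε₁0 : 0 < ε₁ := by positivity
  have hε₂0 : 0 < ε₂ := by positivity
  have hθℓ : 8 * ((ℓ : ℝ) + 1) ^ 2 * θ = 1 := by rw [hθ]; field_simp
  have hθ1 : θ ≤ 1 := by
    nlinarith [mul_nonneg hℓ0.le hθ0.le, mul_nonneg (mul_nonneg hℓ0.le hℓ0.le) hθ0.le]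
  have hγ1 : γ ≤ 1 := by
    have : θ ^ ℓ ≤ 1 := pow_le_one₀ hθ0.le hθ1
    linarith
  refine ⟨γ ^ (2 * ℓ) / 2 * γ ^ ℓ, min ε₁ ε₂, max 2 (max K₁ K₂), by positivity,
    lt_min hε₁0 hε₂0, ?_⟩
  intro V _ N Sat B d x₀ hK hBd hBn hN hx₀ hL hs h0 h1
  have hB2 : 2 ≤ B := (le_max_left _ _).trans hK
  have hBK₁ : K₁ ≤ B := ((le_max_left _ _).trans (le_max_right _ _)).trans hK
  have hBK₂ : K₂ ≤ B := ((le_max_right _ _).trans (le_max_right _ _)).trans hK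
  have hB0 : 0 < B := by linarith
  have hd : 0 < d := by exact_mod_cast hB0.trans_le hBd
  have hε0 : 0 ≤ min ε₁ ε₂ := (lt_min hε₁0 hε₂0).le
  obtain ⟨t, x, ht, htℓ, ⟨F⟩⟩ := exists_frame_of_outWalks (θ := θ) (γ := γ) hℓ hd hN hB2 hBd hBn hx₀ hL hε0
    h0 h1 hθ0 hθℓ (by rw [hγ]; ring) (by
      calc (2 : ℝ) ^ ℓ * min ε₁ ε₂ ≤ 2 ^ ℓ * ε₂ := by gcongr; exact min_le_right _ _
        _ = 2 * γ := by rw [hε₂]; field_simp) (by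
      rw [hK₂, div_le_iff₀ hγ0] at hBK₂; linarith)
  obtain ⟨r, rfl⟩ := Nat.exists_eq_add_of_le htℓ
  set m := t + 2 * r with hm
  have hmt : m + t = 2 * (t + r) := by omega
  have hmt' : (m : ℝ) + t = 2 * ((t + r : ℕ) : ℝ) := by exact_mod_cast hmt
  have hbd : ⌈γ * B⌉₊ ≤ d := Nat.ceil_le.2 ((mul_le_of_le_one_left hB0.le hγ1).trans hBd)
  have hcount := F.card_goodPairs_ge hN (Nat.le_ceil _) hbd (Nat.le_ceil _) hγ0 hγ1 hB0 hBd hL hε0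
    h0 h1 ht hm (fun S hS => hmt ▸ hs S hS) (by
      rw [hmt', hmt]
      rw [hK₁, div_le_iff₀ (by positivity), pow_succ γ] at hBK₁
      linarith) (by
      rw [hmt', hmt]
      calc _ ≤ 4 * (2 ^ (2 * (t + r)) * (2 * (2 * ((t + r : ℕ) : ℝ))) ^ (2 * (t + r))) * ε₁ := by
            gcongr; exact min_le_left _ _
        _ = _ := by rw [hε₁]; field_simp)
  set G := (F.pairs m).filter fun p => GoodCycle Sat (m + t) (closeUp m t p) with hG
  have hGs : G ⊆ F.pairs m := filter_subset _ _
  refine ⟨x, G.image (closeUp m t), ?_, ?_⟩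
  · rw [card_image_of_injOn (F.closeUp_injOn.mono (by exact_mod_cast hGs))]
    refine le_trans ?_ hcount
    rw [hmt, mul_assoc]
    refine mul_le_mul_of_nonneg_left ?_ (by positivity)
    rw [← prod_range_mul_prod_Ico _ (show t ≤ m by omega), prod_stepBound_range, hm,
      prod_stepBound_Ico]
    have h2 : γ * B ≤ (⌈γ * B⌉₊ : ℝ) := Nat.le_ceil _
    have h3 : γ * B ^ (t - 1) ≤ (⌈γ * B ^ (t - 1)⌉₊ : ℝ) := Nat.le_ceil _
    have h4 : γ ^ (t + r) ≤ γ ^ (r + 1) := pow_le_pow_of_le_one hγ0.le hγ1 (by omega)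
    have h5 : B ^ (t + r - 1) = B ^ r * B ^ (t - 1) := by rw [← pow_add]; congr 1; omega
    calc γ ^ (t + r) * ((d : ℝ) ^ (t + r) * B ^ (t + r - 1))
        ≤ γ ^ (r + 1) * ((d : ℝ) ^ (t + r) * B ^ (t + r - 1)) := by gcongr
      _ = (d : ℝ) ^ t * (γ * B * d) ^ r * (γ * B ^ (t - 1)) := by
        rw [h5, mul_pow, mul_pow]; ring
      _ ≤ _ := by gcongr
  · intro w hw
    obtain ⟨p, hp, rfl⟩ := mem_image.1 hw
    have hp1 := hGs hp
    have hp2 := (mem_filter.1 hp).2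
    rw [hmt] at hp2
    refine ⟨F.closeUp_zero hp1, fun i hi => ?_, F.closeUp_one_mem (by omega) (by omega) hp1, hp2,
      fun i hi => F.closeUp_adj hp1 (by omega)⟩
    rw [F.closeUp_apply_ge hp1 (by omega), Nat.sub_eq_zero_of_le (by omega)]
    exact (mem_outWalks.1 (F.ret_subset _ (F.mem_pairs.1 hp1).2)).2.1

end CoreCycles

section GreedyFamily

open scoped Classical

/-- A graph with many edges contains a nonempty set of vertices, each having exactly `d` selected
neighbours in the set. -/
theorem exists_regular_neighbours {V : Type*} [Fintype V] (G : Finset (Finset V))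
    (hG : ∀ e ∈ G, e.card = 2) {d : ℕ} (hd : (Fintype.card V : ℝ) * d < G.card) :
    ∃ (N : V → Finset V) (U : Finset V), U.Nonempty ∧ (∀ v, (N v).card ≤ d) ∧
      (∀ v ∈ U, (N v).card = d) ∧ (∀ v, N v ⊆ U) ∧ ∀ u, ∀ v ∈ N u, {u, v} ∈ G := by
  obtain ⟨U, -, h1, h2⟩ := exists_cleaned G univ id (fun _ _ => subset_univ _) (fun _ => (d : ℝ))
    fun _ => Nat.cast_nonneg _
  rw [sum_const, card_univ, nsmul_eq_mul] at h1
  have hU : U.Nonempty := by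
    obtain ⟨e, he⟩ := card_pos.1 (show 0 < (G.filter fun e => id e ⊆ U).card by
      exact_mod_cast (by linarith : (0 : ℝ) < (G.filter fun e => id e ⊆ U).card))
    obtain ⟨he1, he2 : e ⊆ U⟩ := mem_filter.1 he
    exact (card_pos.1 (by rw [hG e he1]; norm_num)).mono he2
  have h3 : ∀ u, ∃ M ⊆ U.filter fun v => {u, v} ∈ G, M.card ≤ d ∧ (u ∈ U → M.card = d) := by
    intro u
    by_cases hu : u ∈ U
    · have h4 : d ≤ (U.filter fun v => {u, v} ∈ G).card := by
        have h5 : (d : ℝ) ≤ _ := h2 u hu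
        refine (Nat.cast_le.1 h5).trans ((card_le_card ?_).trans
          (card_image_le (f := fun v => ({u, v} : Finset V))))
        intro e he
        obtain ⟨he1, he2 : u ∈ e⟩ := mem_filter.1 he
        obtain ⟨he1, he3 : e ⊆ U⟩ := mem_filter.1 he1
        obtain ⟨v, hv⟩ := card_eq_one.1
          (show (e.erase u).card = 1 by rw [card_erase_of_mem he2, hG e he1])
        have hev : {u, v} = e := by rw [← insert_erase he2, hv]
        refine mem_image.2 ⟨v, mem_filter.2 ⟨he3 ?_, hev ▸ he1⟩, hev⟩
        rw [← hev]; simp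
      obtain ⟨M, hM, hMc⟩ := exists_subset_card_eq h4
      exact ⟨M, hM, hMc.le, fun _ => hMc⟩
    · exact ⟨∅, empty_subset _, by simp, fun h => absurd h hu⟩
  choose N hN1 hN2 hN3 using h3
  exact ⟨N, U, hU, hN2, hN3, fun v w hw => (mem_filter.1 (hN1 v hw)).1,
    fun u v hv => (mem_filter.1 (hN1 u hv)).2⟩

theorem le_card_outWalks {V : Type*} [Fintype V] {N : V → Finset V} {U : Finset V} {d : ℕ}
    (hU : ∀ v ∈ U, (N v).card = d) (hNU : ∀ v, N v ⊆ U) {x : V} (hx : x ∈ U) (L : ℕ) :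
    (d : ℝ) ^ L ≤ (outWalks N x L).card := by
  have := le_card_extensions (P := {fun _ => x}) (σ := fun _ w => N (w _)) (Nat.zero_le L)
    (a := fun _ => (d : ℝ)) (fun _ => Nat.cast_nonneg _) (by
      intro w hw
      rw [mem_singleton.1 hw, mem_seqs]
      exact fun _ _ => rfl) (by
      intro i _ _ w hw
      obtain ⟨-, h1, h2⟩ := mem_outWalks.1 hw
      have h3 : w i ∈ U := by
        rcases Nat.eq_zero_or_pos i with rfl | hi
        · rwa [h1]
        · have := h2 (i - 1) (by omega)
          rw [Nat.sub_add_cancel hi] at this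
          exact hNU _ this
      rw [hU _ h3])
  rw [outWalks]
  simpa using this

/-- The number of members of `F` containing `S`. -/
noncomputable def famDegree {W : Type*} [DecidableEq W] (F : Finset (Finset W)) (S : Finset W) : ℕ :=
  (F.filter fun A => S ⊆ A).card

theorem card_mul_famDegree_le {W : Type*} [DecidableEq W] {F : Finset (Finset W)} {L : ℕ}
    (hF : ∀ A ∈ F, A.card ≤ L) (S : Finset W) (𝒰 : Finset (Finset W))
    {τ : ℝ} (h𝒰 : ∀ U ∈ 𝒰, τ ≤ famDegree F (S ∪ U)) :
    𝒰.card * τ ≤ 2 ^ L * famDegree F S := by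
  have h1 : ∑ U ∈ 𝒰, famDegree F (S ∪ U) ≤ 2 ^ L * famDegree F S := by
    have h2 := sum_card_bipartiteAbove_eq_sum_card_bipartiteBelow (s := 𝒰)
      (t := F.filter fun A => S ⊆ A) (r := fun U A => U ⊆ A)
    calc ∑ U ∈ 𝒰, famDegree F (S ∪ U)
        = ∑ U ∈ 𝒰, (bipartiteAbove (fun U A => U ⊆ A) (F.filter fun A => S ⊆ A) U).card := by
          refine sum_congr rfl fun U _ => ?_
          rw [famDegree, bipartiteAbove, filter_filter]
          simp only [union_subset_iff]
      _ = _ := h2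
      _ ≤ (F.filter fun A => S ⊆ A).card * 2 ^ L := by
          refine sum_le_card_nsmul _ _ _ fun A hA => ?_
          refine (card_le_card (t := A.powerset) ?_).trans ?_
          · intro U hU
            exact mem_powerset.2 (mem_filter.1 hU).2
          · rw [card_powerset]
            exact Nat.pow_le_pow_right (by norm_num) (hF A (mem_filter.1 hA).1)
      _ = _ := by rw [famDegree, mul_comm]
  calc 𝒰.card * τ = ∑ _U ∈ 𝒰, τ := by rw [sum_const, nsmul_eq_mul]
    _ ≤ ∑ U ∈ 𝒰, (famDegree F (S ∪ U) : ℝ) := sum_le_sum h𝒰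
    _ ≤ _ := by exact_mod_cast h1

/-- The nonempty sets of fewer than `L` edges whose degree has reached the threshold `τ`. -/
def Saturated {W : Type*} [DecidableEq W] (F : Finset (Finset W)) (τ : ℕ → ℝ) (L : ℕ) (S : Finset W) : Prop :=
  S.Nonempty ∧ S.card < L ∧ τ S.card ≤ famDegree F S

theorem linkBound_saturated {V : Type*} {F : Finset (Finset (Finset V))} {τ : ℕ → ℝ}
    {L : ℕ} {ε B : ℝ} (hF : ∀ A ∈ F, A.card ≤ L) (hτ0 : ∀ j, 0 < τ j) (hε : 0 ≤ ε) (hB : 0 ≤ B)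
    (hτ : ∀ s j, 1 ≤ j → 2 ^ L * τ s ≤ ε * B ^ j * τ (s + j)) :
    LinkBound (Saturated F τ L) ε B := by
  intro S hS hSat j hj 𝒰 h𝒰
  rcases 𝒰.eq_empty_or_nonempty with rfl | ⟨U₀, hU₀⟩
  · rw [card_empty, Nat.cast_zero]; positivity
  · have hcard : ∀ U ∈ 𝒰, (S ∪ U).card = S.card + j := fun U hU => by
      obtain ⟨h1, h2, -⟩ := h𝒰 U hU
      rw [card_union_of_disjoint h2, h1]
    have hlt : S.card < L := by
      have := (h𝒰 U₀ hU₀).2.2.2.1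
      rw [hcard U₀ hU₀] at this; omega
    have hdeg : (famDegree F S : ℝ) < τ S.card := by
      by_contra h
      exact hSat ⟨hS, hlt, not_lt.1 h⟩
    have h1 := card_mul_famDegree_le hF S 𝒰 (τ := τ (S.card + j)) fun U hU => by
      have := (h𝒰 U hU).2.2.2.2
      rwa [hcard U hU] at this
    refine le_of_mul_le_mul_right (h1.trans (le_trans ?_ (hτ S.card j hj))) (hτ0 (S.card + j))
    gcongr

theorem card_saturated_edges_mul_le {W : Type*} [DecidableEq W] {F : Finset (Finset W)} {L : ℕ}
    (hF : ∀ A ∈ F, A.card ≤ L) (G : Finset W) {τ : ℝ}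
    (hG : ∀ e ∈ G, τ ≤ famDegree F {e}) : G.card * τ ≤ L * F.card := by
  have h1 : ∑ e ∈ G, famDegree F {e} ≤ L * F.card := by
    have h2 := sum_card_bipartiteAbove_eq_sum_card_bipartiteBelow (s := G) (t := F)
      (r := fun e A => e ∈ A)
    calc ∑ e ∈ G, famDegree F {e} = ∑ e ∈ G, (bipartiteAbove (fun e A => e ∈ A) F e).card := by
          refine sum_congr rfl fun e _ => ?_
          rw [famDegree, bipartiteAbove]
          simp only [singleton_subset_iff]
      _ = _ := h2
      _ ≤ F.card * L := by
          refine sum_le_card_nsmul _ _ _ fun A hA => (card_le_card ?_).trans (hF A hA)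
          intro e he
          exact (mem_filter.1 he).2
      _ = _ := mul_comm _ _
  calc G.card * τ = ∑ _e ∈ G, τ := by rw [sum_const, nsmul_eq_mul]
    _ ≤ ∑ e ∈ G, (famDegree F {e} : ℝ) := sum_le_sum hG
    _ ≤ _ := by exact_mod_cast h1

/-- A closed sequence tracing a cycle is determined, up to few possibilities, by its edges. -/
theorem card_le_mul_card_edges {V : Type*} {L : ℕ} {x : V} (𝒲 : Finset (ℕ → V))
    (h𝒲 : ∀ w ∈ 𝒲, ∀ i, L ≤ i → w i = x) :
    (𝒲.card : ℝ) ≤ (2 * L) ^ L * (𝒲.image fun w => edges w (range L)).card := by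
  refine card_le_mul_card_of_fibers (fun w => edges w (range L))
    (fun w hw => mem_image_of_mem (fun w : ℕ → V => edges w (range L)) hw) fun A hA => ?_
  obtain ⟨w₀, -, rfl⟩ := mem_image.1 hA
  set A := edges w₀ (range L) with hA
  have h1 : (A.biUnion id).card ≤ 2 * L := by
    refine (card_biUnion_id_le fun e he => ?_).trans (Nat.mul_le_mul_left _ ?_)
    · obtain ⟨i, -, rfl⟩ := mem_image.1 he
      exact card_edge_le _ _
    · exact card_image_le.trans (card_range L).le
  have h2 : ((range L).pi fun _ => A.biUnion id).card = (A.biUnion id).card ^ L := by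
    rw [card_pi, prod_const, card_range]
  have h3 : ((𝒲.filter fun w => edges w (range L) = A).card) ≤ (A.biUnion id).card ^ L := by
    rw [← h2]
    refine card_le_card_of_injOn (fun w k _ => w k) ?_ ?_
    · intro w hw
      have h4 := (mem_filter.1 hw).2
      refine Finset.mem_pi.2 fun k hk => mem_biUnion.2 ⟨edge w k, ?_, left_mem_edge _ _⟩
      rw [← h4]; exact mem_image_of_mem _ hk
    · intro w hw w' hw' h
      funext k
      rcases Nat.lt_or_ge k L with hk | hk
      · exact congrFun (congrFun h k) (mem_range.2 hk)
      · rw [h𝒲 w (mem_filter.1 hw).1 k hk, h𝒲 w' (mem_filter.1 hw').1 k hk]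
  refine (Nat.cast_le.2 (h3.trans (Nat.pow_le_pow_left h1 L))).trans (le_of_eq ?_)
  push_cast; ring

/-- `A` is the edge set of a cycle of length `L` in `G`. -/
def IsCycleIn {V : Type*} (L : ℕ) (G A : Finset (Finset V)) : Prop :=
  ∃ w : ℕ → V, Set.InjOn w (Set.Iio L) ∧ w L = w 0 ∧ A = edges w (range L) ∧ A ⊆ G

theorem IsCycleIn.card_le {V : Type*} {L : ℕ} {G A : Finset (Finset V)} (h : IsCycleIn L G A) :
    A.card ≤ L := by
  obtain ⟨w, -, -, rfl, -⟩ := h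
  exact card_image_le.trans (card_range L).le

theorem card_le_mul_of_unsaturated {V : Type*} {F : Finset (Finset (Finset V))} {L d : ℕ}
    (hL : 2 ≤ L) {τ : ℕ → ℝ} (hτ : 0 ≤ τ 1) {M : Finset V} (hM : M.card ≤ d) {x : V}
    (hMF : ∀ y ∈ M, ¬ Saturated F τ L {{x, y}}) (𝒜 : Finset (Finset (Finset V))) (h𝒜 : 𝒜 ⊆ F)
    (h𝒜M : ∀ A ∈ 𝒜, ∃ y ∈ M, {x, y} ∈ A) : (𝒜.card : ℝ) ≤ d * τ 1 := by
  have h1 : 𝒜 ⊆ M.biUnion fun y => F.filter fun A => {{x, y}} ⊆ A := by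
    intro A hA
    obtain ⟨y, hy, hyA⟩ := h𝒜M A hA
    exact mem_biUnion.2 ⟨y, hy, mem_filter.2 ⟨h𝒜 hA, singleton_subset_iff.2 hyA⟩⟩
  have h2 : 𝒜.card ≤ ∑ y ∈ M, famDegree F {{x, y}} := (card_le_card h1).trans card_biUnion_le
  have h3 : ∀ y ∈ M, (famDegree F {{x, y}} : ℝ) ≤ τ 1 := by
    intro y hy
    by_contra h
    refine hMF y hy ⟨singleton_nonempty _, ?_, ?_⟩
    · rw [card_singleton]; omega
    · rw [card_singleton]; exact (not_le.1 h).le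
  have h4 : (𝒜.card : ℝ) ≤ ∑ y ∈ M, (famDegree F {{x, y}} : ℝ) := by exact_mod_cast h2
  refine (h4.trans (sum_le_sum h3)).trans ?_
  rw [sum_const, nsmul_eq_mul]
  exact mul_le_mul_of_nonneg_right (Nat.cast_le.2 hM) hτ

/-- A small family of cycles can be enlarged by a cycle without saturated sets of edges. -/
theorem exists_unsaturated_cycle {ℓ : ℕ} (hℓ : 2 ≤ ℓ) : ∃ c ε K : ℝ, 0 < c ∧ 0 < ε ∧ ε ≤ 1 ∧
    ∀ {V : Type} [Fintype V] (G : Finset (Finset V)) (F : Finset (Finset (Finset V)))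
      (B : ℝ) (d : ℕ) (τ : ℕ → ℝ), (∀ e ∈ G, e.card = 2) → (∀ A ∈ F, A.card ≤ 2 * ℓ) → K ≤ B →
      0 ≤ B → B ≤ d → B ^ (ℓ - 1) * Fintype.card V ≤ (d : ℝ) ^ ℓ → (∀ j, 0 < τ j) →
      (∀ s j, 1 ≤ j → τ s ≤ ε * B ^ j * τ (s + j)) → d * τ 1 < c * ((d : ℝ) ^ ℓ * B ^ (ℓ - 1)) →
      (2 * ℓ) * F.card < τ 1 * (G.card - Fintype.card V * d) →
      ∃ A, IsCycleIn (2 * ℓ) G A ∧ A ∉ F ∧ ∀ S ⊆ A, ¬ Saturated F τ (2 * ℓ) S := by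
  obtain ⟨c, ε, K, hc, hε, hcore⟩ := exists_goodCycles hℓ
  have hℓ0 : (0 : ℝ) < ℓ := by exact_mod_cast (by omega : 0 < ℓ)
  refine ⟨c / (2 * (2 * ℓ)) ^ (2 * ℓ), min (ε / 2 ^ (2 * ℓ)) 1, K, by positivity,
    lt_min (by positivity) one_pos, min_le_right _ _, ?_⟩
  intro V _ G F B d τ hG hF hK hB0 hBd hBn hτ0 hτ hcτ hFG
  set G' := G.filter fun e => ¬ Saturated F τ (2 * ℓ) {e} with hG'
  have hG'G : G' ⊆ G := filter_subset _ _
  have hG'c : (Fintype.card V : ℝ) * d < G'.card := by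
    have h1 := card_saturated_edges_mul_le hF (G.filter fun e => Saturated F τ (2 * ℓ) {e})
      (τ := τ 1) fun e he => by
        have := (mem_filter.1 he).2.2.2
        rwa [card_singleton] at this
    have h2 : ((G.filter fun e => Saturated F τ (2 * ℓ) {e}).card : ℝ) + G'.card = G.card := by
      exact_mod_cast card_filter_add_card_filter_not _
    have h3 : τ 1 * (G.filter fun e => Saturated F τ (2 * ℓ) {e}).card <
        τ 1 * (G.card - Fintype.card V * d) := by
      push_cast at h1
      linarith
    have h4 := lt_of_mul_lt_mul_left h3 (hτ0 1).le
    linarith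
  obtain ⟨N, U, ⟨x₀, hx₀⟩, hN, hNU, hNsub, hNG⟩ :=
    exists_regular_neighbours G' (fun e he => hG e (hG'G he)) hG'c
  obtain ⟨x, 𝒲, h𝒲c, h𝒲⟩ := hcore (N := N) (Sat := Saturated F τ (2 * ℓ)) hK hBd hBn hN
    (le_card_outWalks hNU hNsub hx₀ ℓ)
    (linkBound_saturated hF hτ0 hε.le hB0 fun s j hj => by
      have h1 := hτ s j hj
      have h2 : min (ε / 2 ^ (2 * ℓ)) 1 * B ^ j * τ (s + j) ≤
          ε / 2 ^ (2 * ℓ) * B ^ j * τ (s + j) := by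
        have := (hτ0 (s + j)).le
        gcongr
        exact min_le_left _ _
      calc 2 ^ (2 * ℓ) * τ s ≤ 2 ^ (2 * ℓ) * (ε / 2 ^ (2 * ℓ) * B ^ j * τ (s + j)) := by
            gcongr; exact h1.trans h2
        _ = _ := by field_simp)
    (fun S hS => hS.2.1) (fun h => h.1.ne_empty rfl)
    (fun u v hv => (mem_filter.1 (hNG u v hv)).2)
  have hadj : ∀ w ∈ 𝒲, ∀ i < 2 * ℓ, edge w i ∈ G' := by
    intro w hw i hi
    rcases (h𝒲 w hw).2.2.2.2 i hi with h | h
    · exact hNG _ _ h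
    · rw [edge, pair_comm]; exact hNG _ _ h
  have hcyc : ∀ w ∈ 𝒲, IsCycleIn (2 * ℓ) G (edges w (range (2 * ℓ))) := by
    intro w hw
    obtain ⟨h1, h2, -, h3, -⟩ := h𝒲 w hw
    refine ⟨w, h3.1, by rw [h1, h2 _ le_rfl], rfl, ?_⟩
    intro e he
    obtain ⟨i, hi, rfl⟩ := mem_image.1 he
    exact hG'G (hadj w hw i (mem_range.1 hi))
  by_contra hcon
  push Not at hcon
  have hinF : ∀ w ∈ 𝒲, edges w (range (2 * ℓ)) ∈ F := by
    intro w hw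
    by_contra h
    obtain ⟨S, hS, hSat⟩ := hcon _ (hcyc w hw) h
    exact (h𝒲 w hw).2.2.2.1.2 S hS hSat
  have h1 := card_le_mul_card_edges (L := 2 * ℓ) 𝒲 fun w hw => (h𝒲 w hw).2.1
  have h2 : ((𝒲.image fun w => edges w (range (2 * ℓ))).card : ℝ) ≤ d * τ 1 := by
    refine card_le_mul_of_unsaturated (F := F) (L := 2 * ℓ) (by omega) (hτ0 1).le (hN x)
      (fun y hy => (mem_filter.1 (hNG x y hy)).2) _ ?_ ?_
    · intro A hA
      obtain ⟨w, hw, rfl⟩ := mem_image.1 hA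
      exact hinF w hw
    · intro A hA
      obtain ⟨w, hw, rfl⟩ := mem_image.1 hA
      obtain ⟨h4, -, h5, -⟩ := h𝒲 w hw
      refine ⟨w 1, h5, ?_⟩
      rw [← h4]
      exact mem_image_of_mem (edge w) (mem_range.2 (by omega : 0 < 2 * ℓ))
  push_cast at h1
  have h3 : (0 : ℝ) < (2 * (2 * ℓ)) ^ (2 * ℓ) := by positivity
  rw [div_mul_eq_mul_div, lt_div_iff₀ h3] at hcτ
  have h4 := mul_le_mul_of_nonneg_left h2 h3.le
  linarith

/-- If `τ` satisfies the conditions of the greedy construction then there is a large family of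
cycles whose degrees are bounded by `τ`. -/
theorem exists_balanced_family {ℓ : ℕ} (hℓ : 2 ≤ ℓ) : ∃ c ε K : ℝ, 0 < c ∧ 0 < ε ∧ ε ≤ 1 ∧
    ∀ {V : Type} [Fintype V] (G : Finset (Finset V)) (B : ℝ) (d : ℕ) (τ : ℕ → ℝ) (T : ℝ),
      (∀ e ∈ G, e.card = 2) → K ≤ B →
      0 ≤ B → B ≤ d → B ^ (ℓ - 1) * Fintype.card V ≤ (d : ℝ) ^ ℓ → (∀ j, 0 < τ j) →
      (∀ s j, 1 ≤ j → τ s ≤ ε * B ^ j * τ (s + j)) → d * τ 1 < c * ((d : ℝ) ^ ℓ * B ^ (ℓ - 1)) →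
      (2 * ℓ) * T ≤ τ 1 * (G.card - Fintype.card V * d) →
      ∃ F : Finset (Finset (Finset V)), (∀ A ∈ F, IsCycleIn (2 * ℓ) G A) ∧ T ≤ F.card ∧
        ∀ S, S.Nonempty → S.card < 2 * ℓ → (famDegree F S : ℝ) ≤ τ S.card + 1 := by
  obtain ⟨c, ε, K, hc, hε, hε1, hcore⟩ := exists_unsaturated_cycle hℓ
  refine ⟨c, ε, K, hc, hε, hε1, ?_⟩
  intro V _ G B d τ T hG hK hB0 hBd hBn hτ0 hτ hcτ hT
  obtain ⟨F, hF, hmax⟩ := exists_max_image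
    ((univ : Finset (Finset (Finset (Finset V)))).filter fun F => (∀ A ∈ F, IsCycleIn (2 * ℓ) G A) ∧
      ∀ S, S.Nonempty → S.card < 2 * ℓ → (famDegree F S : ℝ) ≤ τ S.card + 1) card ⟨∅, by
        refine mem_filter.2 ⟨mem_univ _, by simp, fun S _ _ => ?_⟩
        have := hτ0 S.card
        simp only [famDegree, filter_empty, card_empty, Nat.cast_zero]
        linarith⟩
  obtain ⟨-, hF1, hF2⟩ := mem_filter.1 hF
  refine ⟨F, hF1, ?_, hF2⟩
  by_contra hlt
  rw [not_le] at hlt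
  obtain ⟨A, hA1, hA2, hA3⟩ := hcore G F B d τ hG (fun A hA => (hF1 A hA).card_le) hK hB0 hBd hBn
    hτ0 hτ hcτ (lt_of_lt_of_le (by
      have : (0 : ℝ) < ℓ := by exact_mod_cast (by omega : 0 < ℓ)
      gcongr) hT)
  have h1 := hmax (insert A F) (mem_filter.2 ⟨mem_univ _, fun A' hA' => ?_, fun S hS hSc => ?_⟩)
  · rw [card_insert_of_notMem hA2] at h1
    omega
  · rcases mem_insert.1 hA' with rfl | h
    · exact hA1
    · exact hF1 A' h
  · rw [famDegree, filter_insert]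
    split_ifs with h
    · have h2 : (famDegree F S : ℝ) < τ S.card := by
        by_contra h3
        exact hA3 S h ⟨hS, hSc, not_lt.1 h3⟩
      refine (Nat.cast_le.2 (card_insert_le _ _)).trans ?_
      push_cast
      rw [famDegree] at h2
      linarith
    · exact hF2 S hS hSc

end GreedyFamily

section Thresholds

theorem IsCycleIn.isCopy {n m : ℕ} {G A : Finset (Finset (Fin n))}
    (h : IsCycleIn m G A) : IsCopy (cycleGraph m) G A := by
  obtain ⟨w, hw, hwm, rfl, hG⟩ := h
  have hedge : ∀ i : Fin m, ({i, ⟨(i.val + 1) % m, Nat.mod_lt _ i.pos⟩} : Finset (Fin m)).image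
      (fun j => w j.val) = edge w i := by
    intro i
    have h1 : w ((i.val + 1) % m) = w (i.val + 1) := by
      rcases Nat.lt_or_ge (i.val + 1) m with h2 | h2
      · rw [Nat.mod_eq_of_lt h2]
      · have h3 : i.val + 1 = m := le_antisymm i.isLt h2
        rw [h3, Nat.mod_self, hwm]
    ext v
    simp [edge, h1]
  refine ⟨fun i => w i.val, fun i j hij => Fin.ext (hw i.isLt j.isLt hij), ?_, hG⟩
  ext e
  simp only [edges, cycleGraph, mem_image, mem_range, mem_univ, true_and, exists_exists_eq_and]
  constructor
  · rintro ⟨i, hi, rfl⟩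
    exact ⟨⟨i, hi⟩, hedge ⟨i, hi⟩⟩
  · rintro ⟨i, rfl⟩
    exact ⟨i, i.isLt, (hedge i).symm⟩

theorem pow_div_pow_eq_rpow {b : ℝ} (hb : 0 < b) {ℓ : ℕ} (hℓ : 2 ≤ ℓ) (i : ℕ) :
    b ^ (2 * ℓ - 1) / (b * b ^ (1 / ((ℓ : ℝ) - 1))) ^ i =
      b ^ (2 * (ℓ : ℝ) - (i + 1) - (i + 1 - 1) / ((ℓ : ℝ) - 1)) := by
  have h1 : b * b ^ (1 / ((ℓ : ℝ) - 1)) = b ^ (1 + 1 / ((ℓ : ℝ) - 1)) := by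
    rw [Real.rpow_add hb, Real.rpow_one]
  rw [h1, ← Real.rpow_natCast, ← Real.rpow_natCast, ← Real.rpow_mul hb.le, ← Real.rpow_sub hb]
  congr 1
  rw [Nat.cast_sub (by omega)]
  push_cast
  ring

theorem neg_one_le_exponent {ℓ i : ℕ} (hℓ : 2 ≤ ℓ) (hi : i + 1 ≤ 2 * ℓ - 1) :
    -1 ≤ 2 * (ℓ : ℝ) - (i + 1) - (i + 1 - 1) / ((ℓ : ℝ) - 1) := by
  have h1 : (2 : ℝ) ≤ ℓ := by exact_mod_cast hℓ
  have h2 : (i : ℝ) ≤ 2 * ((ℓ : ℝ) - 1) := by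
    have : (i : ℝ) + 2 ≤ 2 * ℓ := by exact_mod_cast (by omega : i + 2 ≤ 2 * ℓ)
    linarith
  have h3 : ((i : ℝ) + 1 - 1) / ((ℓ : ℝ) - 1) ≤ 2 := by
    rw [div_le_iff₀ (by linarith)]; linarith
  linarith

/-- The largest degree allowed for a set of `j` edges. -/
noncomputable def threshold (X B D : ℝ) (j : ℕ) : ℝ := X * (B / D) * (D / B) ^ j

theorem threshold_succ {X B D : ℝ} (hB : 0 < B) (hD : 0 < D) (i : ℕ) :
    threshold X B D (i + 1) = D ^ i * (X / B ^ i) := by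
  rw [threshold, pow_succ, div_pow]
  field_simp

theorem threshold_le {X B ε : ℝ} (hX : 0 < X) (hB : 0 < B) (hε : 0 < ε) (hε1 : ε ≤ 1) (s : ℕ)
    {j : ℕ} (hj : 1 ≤ j) :
    threshold X B ε⁻¹ s ≤ ε * B ^ j * threshold X B ε⁻¹ (s + j) := by
  obtain ⟨j, rfl⟩ := Nat.exists_eq_add_of_le' hj
  have h1 : ε * B ^ (j + 1) * threshold X B ε⁻¹ (s + (j + 1)) =
      (ε⁻¹) ^ j * threshold X B ε⁻¹ s := by
    rw [threshold, threshold, pow_add (ε⁻¹ / B), div_pow _ _ (j + 1), pow_succ ε⁻¹]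
    field_simp
  rw [h1]
  refine le_mul_of_one_le_left ?_ (one_le_pow₀ (one_le_inv_iff₀.2 ⟨hε, hε1⟩))
  rw [threshold]; positivity

theorem card_le_sq_of_uniform {n : ℕ} {G : Finset (Finset (Fin n))} (hG : UniformHG 2 G) :
    (G.card : ℝ) ≤ (n : ℝ) ^ 2 := by
  have h1 : G.card ≤ (powersetCard 2 (univ : Finset (Fin n))).card :=
    card_le_card fun e he => mem_powersetCard.2 ⟨subset_univ _, hG e he⟩
  rw [card_powersetCard, card_univ, Fintype.card_fin] at h1
  exact_mod_cast h1.trans (Nat.choose_le_pow n 2)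

theorem degF_eq_famDegree {W : Type*} [DecidableEq W] (inst : DecidableEq (Finset W))
    (F : Finset (Finset (Finset W))) (S : Finset (Finset W)) :
    degF F S = @famDegree (Finset W) inst F S := by
  rw [degF, famDegree]
  congr!

/-- The family of cycles for a graph on at least one vertex, with `ν` the `ℓ`-th root of the number
of vertices and `8 * b` the density parameter. -/
theorem exists_balanced_family_of_density {ℓ : ℕ} (hℓ : 2 ≤ ℓ) :
    ∃ c D K : ℝ, 0 < c ∧ 1 ≤ D ∧ ∀ (n : ℕ) (ν b : ℝ) (G : Finset (Finset (Fin n))),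
      UniformHG 2 G → 0 < ν → ν ^ ℓ = n → 1 ≤ b → K ≤ b → (G.card : ℝ) = 8 * b * (n * ν) →
      ∃ F : Finset (Finset (Finset (Fin n))), (∀ A ∈ F, IsCopy (cycleGraph (2 * ℓ)) G A) ∧
        c / ℓ * b ^ (2 * ℓ) * (n : ℝ) ^ 2 ≤ F.card ∧
        ∀ S : Finset (Finset (Fin n)), ∀ i, S.card = i + 1 → i + 1 ≤ 2 * ℓ - 1 →
          (degF F S : ℝ) ≤ c * D ^ (2 * ℓ) *
            b ^ (2 * (ℓ : ℝ) - (i + 1) - (i + 1 - 1) / ((ℓ : ℝ) - 1)) * ν ^ (ℓ - 1) + 1 := by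
  obtain ⟨c, ε, K, hc, hε, hε1, hfam⟩ := exists_balanced_family hℓ
  refine ⟨c / 2, ε⁻¹, K, by positivity, one_le_inv_iff₀.2 ⟨hε, hε1⟩, ?_⟩
  intro n ν b G hG hν hνn hb hK hGc
  have hb0 : 0 < b := by linarith
  have hℓ0 : (0 : ℝ) < ℓ := by exact_mod_cast (by omega : 0 < ℓ)
  have hn : (0 : ℝ) < n := by rw [← hνn]; positivity
  obtain ⟨p, rfl⟩ := Nat.exists_eq_add_of_le' (by omega : 1 ≤ ℓ)
  have hp : 1 ≤ p := by omega
  have hp0 : (p : ℝ) ≠ 0 := by exact_mod_cast (by omega : p ≠ 0)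
  rw [Nat.add_sub_cancel]
  set β : ℝ := b ^ (1 / (((p + 1 : ℕ) : ℝ) - 1)) with hβ
  have hβ0 : 0 < β := Real.rpow_pos_of_pos hb0 _
  have hβp : β ^ p = b := by
    rw [hβ, ← Real.rpow_natCast, ← Real.rpow_mul hb0.le]
    push_cast
    rw [add_sub_cancel_right, one_div, inv_mul_cancel₀ hp0, Real.rpow_one]
  have hβ1 : 1 ≤ β := by
    by_contra h
    have := pow_lt_one₀ hβ0.le (not_le.1 h) (by omega : p ≠ 0)
    linarith
  have hbν : 8 * b ≤ ν ^ p := by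
    have h1 := card_le_sq_of_uniform hG
    rw [hGc] at h1
    have h2 : 8 * b * ν * n ≤ ν ^ p * ν * n := by
      calc 8 * b * ν * n = 8 * b * (n * ν) := by ring
        _ ≤ (n : ℝ) ^ 2 := h1
        _ = ν ^ p * ν * n := by rw [← pow_succ, hνn]; ring
    exact le_of_mul_le_mul_right (le_of_mul_le_mul_right h2 hn) hν
  have hβν : β ≤ ν := by
    refine le_of_pow_le_pow_left₀ (by omega : p ≠ 0) hν.le ?_
    rw [hβp]; linarith
  set B := b * β with hB
  have hB0 : 0 < B := by positivity
  have hBp : B ^ p = b ^ (p + 1) := by rw [hB, mul_pow, hβp, pow_succ]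
  set d := ⌈b * ν⌉₊ with hd
  have hbν1 : 1 ≤ b * ν := by nlinarith
  have hd1 : b * ν ≤ d := Nat.le_ceil _
  have hd2 : (d : ℝ) ≤ 2 * (b * ν) := by
    have := Nat.ceil_lt_add_one (by positivity : 0 ≤ b * ν)
    linarith
  set X := c / 2 * (b ^ (2 * p + 1) * ν ^ p) with hX
  have hX0 : 0 < X := by positivity
  have hdB : b ^ (2 * p + 1) * ν ^ p ≤ (d : ℝ) ^ p * B ^ p := by
    calc b ^ (2 * p + 1) * ν ^ p = (b * ν) ^ p * b ^ (p + 1) := by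
          rw [mul_pow, two_mul, add_assoc, pow_add]; ring
      _ ≤ (d : ℝ) ^ p * B ^ p := by rw [hBp]; gcongr
  have hτ1 : threshold X B ε⁻¹ 1 = X := by
    have := threshold_succ (X := X) hB0 (inv_pos.2 hε) 0
    simpa using this
  obtain ⟨F, hF1, hF2, hF3⟩ := hfam G B d (threshold X B ε⁻¹)
    (c / 2 / ((p + 1 : ℕ) : ℝ) * b ^ (2 * (p + 1)) * (n : ℝ) ^ 2) hG
    (hK.trans (le_mul_of_one_le_right hb0.le hβ1)) hB0.le
    ((mul_le_mul_of_nonneg_left hβν hb0.le).trans hd1)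
    (by
      rw [Nat.add_sub_cancel, Fintype.card_fin, hBp, ← hνn, ← mul_pow]
      gcongr)
    (fun j => by rw [threshold]; positivity)
    (fun s j hj => threshold_le hX0 hB0 hε hε1 s hj)
    (by
      have hd0 : (0 : ℝ) < d := by linarith
      rw [hτ1, Nat.add_sub_cancel, hX]
      have h1 : 0 < b ^ (2 * p + 1) * ν ^ p := by positivity
      calc d * (c / 2 * (b ^ (2 * p + 1) * ν ^ p))
          < d * (c * (b ^ (2 * p + 1) * ν ^ p)) := by
            gcongr; linarith
        _ ≤ d * (c * ((d : ℝ) ^ p * B ^ p)) := by gcongr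
        _ = _ := by ring)
    (by
      rw [hτ1, Fintype.card_fin, hGc]
      have h1 : 6 * (b * (n * ν)) ≤ 8 * b * (n * ν) - n * d := by nlinarith
      calc 2 * ((p + 1 : ℕ) : ℝ) *
            (c / 2 / ((p + 1 : ℕ) : ℝ) * b ^ (2 * (p + 1)) * (n : ℝ) ^ 2)
          = c * b ^ (2 * (p + 1)) * (n : ℝ) ^ 2 := by field_simp
        _ ≤ 3 * (c * b ^ (2 * (p + 1)) * (n : ℝ) ^ 2) := by
            have : 0 < c * b ^ (2 * (p + 1)) * (n : ℝ) ^ 2 := by positivity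
            linarith
        _ = X * (6 * (b * (n * ν))) := by
            rw [hX, show (n : ℝ) ^ 2 = n * (ν ^ (p + 1)) by rw [hνn, sq]]; ring
        _ ≤ _ := by gcongr)
  refine ⟨F, fun A hA => (hF1 A hA).isCopy, hF2, fun S i hS hi => ?_⟩
  have h1 := hF3 S (card_pos.1 (by omega)) (by omega)
  rw [← degF_eq_famDegree _ F S] at h1
  refine h1.trans (add_le_add_left ?_ 1)
  rw [hS, threshold_succ hB0 (inv_pos.2 hε), ← pow_div_pow_eq_rpow hb0 hℓ i, ← hβ, ← hB, hX,
    show 2 * (p + 1) - 1 = 2 * p + 1 by omega]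
  calc ε⁻¹ ^ i * (c / 2 * (b ^ (2 * p + 1) * ν ^ p) / B ^ i)
      ≤ ε⁻¹ ^ (2 * (p + 1)) * (c / 2 * (b ^ (2 * p + 1) * ν ^ p) / B ^ i) := by
        refine mul_le_mul_of_nonneg_right ?_ (by positivity)
        exact pow_le_pow_right₀ (one_le_inv_iff₀.2 ⟨hε, hε1⟩) (by omega)
    _ = _ := by ring

end Thresholds

/-- **Morris–Saxton balanced supersaturation for even cycles.**
For every `ℓ ≥ 2` there are `C, δ > 0` and `k₀ ∈ ℕ` such that every `n`-vertex graph
with `k·n^(1+1/ℓ)` edges, `k ≥ k₀`, contains a family `𝓕` of copies of `C_{2ℓ}` with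
`|𝓕| ≥ δ·k^(2ℓ)·n²` and `d_𝓕(S) ≤ C·k^(2ℓ−|S|−(|S|−1)/(ℓ−1))·n^(1−1/ℓ)` for all
`1 ≤ |S| ≤ 2ℓ−1`. -/
theorem even_cycle_balanced_supersaturation (ℓ : ℕ) (hℓ : 2 ≤ ℓ) :
    ∃ (C δ : ℝ) (k₀ : ℕ), 0 < C ∧ 0 < δ ∧
      ∀ (n : ℕ) (k : ℝ) (G : Finset (Finset (Fin n))),
        UniformHG 2 G → (k₀ : ℝ) ≤ k →
        (G.card : ℝ) = k * (n : ℝ) ^ ((1 : ℝ) + 1 / (ℓ : ℝ)) →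
        ∃ 𝓕 : Finset (Finset (Finset (Fin n))),
          (∀ B ∈ 𝓕, IsCopy (cycleGraph (2 * ℓ)) G B) ∧
          δ * k ^ (2 * ℓ) * (n : ℝ) ^ 2 ≤ (𝓕.card : ℝ) ∧
          ∀ S : Finset (Finset (Fin n)), S ⊆ G → 1 ≤ S.card → S.card ≤ 2 * ℓ - 1 →
            (degF 𝓕 S : ℝ) ≤
              C * k ^ (2 * (ℓ : ℝ) - (S.card : ℝ) - ((S.card : ℝ) - 1) / ((ℓ : ℝ) - 1)) *
                (n : ℝ) ^ ((1 : ℝ) - 1 / (ℓ : ℝ)) := by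
  obtain ⟨c, D, K, hc, hD, hfam⟩ := exists_balanced_family_of_density hℓ
  have hℓ0 : (0 : ℝ) < ℓ := by exact_mod_cast (by omega : 0 < ℓ)
  refine ⟨8 * (c * D ^ (2 * ℓ)) + 1, c / ℓ / 8 ^ (2 * ℓ), ⌈8 * max K 1⌉₊, by positivity,
    by positivity, ?_⟩
  intro n k G hG hk hGc
  have hk8 : 8 * max K 1 ≤ k := (Nat.le_ceil _).trans hk
  have hkK : K ≤ k / 8 := by linarith [le_max_left K 1]
  have hk1 : 1 ≤ k / 8 := by linarith [le_max_right K 1]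
  have hk0 : 0 < k := by linarith
  rcases Nat.eq_zero_or_pos n with rfl | hn
  · refine ⟨∅, by simp, by simp, fun S _ _ _ => ?_⟩
    simp only [degF, filter_empty, card_empty, Nat.cast_zero]
    positivity
  have hn0 : (0 : ℝ) < n := by exact_mod_cast hn
  set ν : ℝ := (n : ℝ) ^ (1 / (ℓ : ℝ)) with hν
  have hν0 : 0 < ν := Real.rpow_pos_of_pos hn0 _
  have hνn : ν ^ ℓ = n := by
    rw [hν, ← Real.rpow_natCast, ← Real.rpow_mul hn0.le, one_div, inv_mul_cancel₀ hℓ0.ne',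
      Real.rpow_one]
  have hνn' : (n : ℝ) ^ ((1 : ℝ) - 1 / (ℓ : ℝ)) = ν ^ (ℓ - 1) := by
    rw [Real.rpow_sub hn0, Real.rpow_one, ← hν, div_eq_iff hν0.ne', ← pow_succ,
      Nat.sub_add_cancel (by omega), hνn]
  rw [Real.rpow_add hn0, Real.rpow_one, ← hν] at hGc
  obtain ⟨F, hF1, hF2, hF3⟩ := hfam n ν (k / 8) G hG hν0 hνn hk1 hkK (by rw [hGc]; ring)
  refine ⟨F, hF1, ?_, fun S _ hS1 hS2 => ?_⟩
  · refine le_trans (le_of_eq ?_) hF2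
    rw [div_pow]; ring
  obtain ⟨i, hi⟩ := Nat.exists_eq_add_of_le' hS1
  have hdeg := hF3 S i hi (hi ▸ hS2)
  rw [hνn', hi]
  push_cast
  have hq := neg_one_le_exponent hℓ (hi ▸ hS2)
  set q : ℝ := 2 * (ℓ : ℝ) - (i + 1) - (i + 1 - 1) / ((ℓ : ℝ) - 1) with hqdef
  have hkν : k ≤ ν ^ (ℓ - 1) := by
    have h1 := card_le_sq_of_uniform hG
    rw [hGc] at h1
    have h2 : k * (ν * n) ≤ ν ^ (ℓ - 1) * (ν * n) := by
      calc k * (ν * n) = k * (n * ν) := by ring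
        _ ≤ (n : ℝ) ^ 2 := h1
        _ = ν ^ (ℓ - 1 + 1) * n := by rw [Nat.sub_add_cancel (by omega), hνn, sq]
        _ = _ := by ring
    exact le_of_mul_le_mul_right h2 (by positivity)
  have h1 : 1 ≤ k ^ q * ν ^ (ℓ - 1) := by
    calc (1 : ℝ) = k ^ (-1 : ℝ) * k := by rw [Real.rpow_neg_one, inv_mul_cancel₀ hk0.ne']
      _ ≤ k ^ q * ν ^ (ℓ - 1) :=
        mul_le_mul (Real.rpow_le_rpow_of_exponent_le (by linarith) hq) hkν hk0.le (by positivity)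
  have h2 : (k / 8) ^ q ≤ 8 * k ^ q := by
    rw [Real.div_rpow hk0.le (by norm_num), div_le_iff₀ (by positivity)]
    have h3 : (8 : ℝ)⁻¹ ≤ 8 ^ q := by
      rw [← Real.rpow_neg_one]
      exact Real.rpow_le_rpow_of_exponent_le (by norm_num) hq
    have h4 : 0 < k ^ q := by positivity
    nlinarith
  calc (degF F S : ℝ) ≤ c * D ^ (2 * ℓ) * (k / 8) ^ q * ν ^ (ℓ - 1) + 1 := hdeg
    _ ≤ c * D ^ (2 * ℓ) * (8 * k ^ q) * ν ^ (ℓ - 1) + k ^ q * ν ^ (ℓ - 1) := by gcongr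
    _ = _ := by ring
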